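/- Let N ≥ 1, m ≥ 1, q ∈ (0,1) and B > 0. Let u_0 ∈ L^∞(ℝ^N) be non-negative and let u be a non-negative weak solution of the spatially homogeneous equation ∂_t u = Δ(u^m) − B u^q with u(0) = u_0. Assume there exists R > 0 such that for a.e. t > 0, u(t,x) = 0 for a.e. x with |x| ≥ R. Then u vanishes in finite time: there exists T_e ∈ (0,∞) such that u(t,x) = 0 for a.e. x ∈ ℝ^N and a.e. t ≥ T_e. -/

import Mathlib

open MeasureTheory Set

noncomputable section

/-- A non-negative weak solution of `∂ₜ u = Δ(uᵐ) − w(x) u^q` on `(0,∞)×ℝᴺ`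
with initial condition `u₀`, in the sense of Definition 1.1 of the paper:
`u` is a bounded non-negative measurable function, and there is a measurable
vector field `g` (the weak spatial gradient of `uᵐ`) which is locally square
integrable on `(0,T)×ℝᴺ`, satisfies the weak derivative identity against test
functions in `C_c^1((0,T)×ℝᴺ)`, and satisfies the weak formulation of the
equation against test functions in `C_c^1([0,T)×ℝᴺ)`. -/
def IsWeakSolution (N : ℕ) (m q : ℝ) (w : EuclideanSpace ℝ (Fin N) → ℝ)
    (u0 : EuclideanSpace ℝ (Fin N) → ℝ)
    (u : ℝ → EuclideanSpace ℝ (Fin N) → ℝ) : Prop :=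
  Measurable (Function.uncurry u) ∧
  (∀ t x, 0 ≤ u t x) ∧
  (∃ C : ℝ, ∀ t x, u t x ≤ C) ∧
  ∃ g : ℝ → EuclideanSpace ℝ (Fin N) → EuclideanSpace ℝ (Fin N),
    Measurable (Function.uncurry g) ∧
    ∀ T > (0:ℝ),
      (∀ K : Set (EuclideanSpace ℝ (Fin N)), IsCompact K →
        ∫⁻ s in Ioo (0:ℝ) T, ∫⁻ x in K, ENNReal.ofReal (‖g s x‖ ^ 2) < ⊤) ∧
      (∀ ζ : ℝ × EuclideanSpace ℝ (Fin N) → ℝ, ContDiff ℝ 1 ζ →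
        HasCompactSupport ζ → (∀ s x, s ∉ Ioo (0:ℝ) T → ζ (s, x) = 0) →
        ∀ i : Fin N,
          (∫ s in Ioo (0:ℝ) T, ∫ x,
              (u s x) ^ m * fderiv ℝ ζ (s, x) (0, EuclideanSpace.single i 1))
            = - ∫ s in Ioo (0:ℝ) T, ∫ x, g s x i * ζ (s, x)) ∧
      (∀ ζ : ℝ × EuclideanSpace ℝ (Fin N) → ℝ, ContDiff ℝ 1 ζ →
        HasCompactSupport ζ → (∀ s x, T ≤ s → ζ (s, x) = 0) →
        ∫ s in Ioo (0:ℝ) T, ∫ x,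
            ((u0 x - u s x) * fderiv ℝ ζ (s, x) (1, 0)
              + fderiv ℝ ζ (s, x) (0, g s x)
              + w x * (u s x) ^ q * ζ (s, x)) = 0)

/-- `u₀` is a non-negative function in `L^∞(ℝᴺ)`. -/
def IsBddNonneg (N : ℕ) (u0 : EuclideanSpace ℝ (Fin N) → ℝ) : Prop :=
  Measurable u0 ∧ (∀ x, 0 ≤ u0 x) ∧ ∃ C : ℝ, ∀ x, u0 x ≤ C

/-- The solution `u` vanishes in finite time. -/
def VanishesInFiniteTime (N : ℕ) (u : ℝ → EuclideanSpace ℝ (Fin N) → ℝ) : Prop :=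
  ∃ Te : ℝ, 0 < Te ∧ ∀ᵐ t : ℝ, Te ≤ t → ∀ᵐ x : EuclideanSpace ℝ (Fin N), u t x = 0

/-- The support of `u(t)` is contained in `B(0,R)` for a.e. `t > 0`. -/
def SupportLocalized (N : ℕ) (R : ℝ) (u : ℝ → EuclideanSpace ℝ (Fin N) → ℝ) : Prop :=
  ∀ᵐ t : ℝ, 0 < t → ∀ᵐ x : EuclideanSpace ℝ (Fin N), R ≤ ‖x‖ → u t x = 0


instance FTE.haar (N : ℕ) :
    (volume : Measure (ℝ × EuclideanSpace ℝ (Fin N))).IsAddHaarMeasure :=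
  Measure.prod.instIsAddHaarMeasure volume volume

lemma FTE.transl {P : Type*} [NormedAddCommGroup P] [NormedSpace ℝ P]
    [FiniteDimensional ℝ P] [MeasureSpace P] [BorelSpace P]
    [(volume : Measure P).IsAddHaarMeasure] {F : Type*} [NormedAddCommGroup F]
    (j : ℕ) (hj : 1 ≤ j) (f : P → F)
    (hf : MemLp f (j : ENNReal) volume) (η : ℝ) (hη : 0 < η) :
    ∃ δ > 0, ∀ y : P, ‖y‖ < δ →
      ∫⁻ x, ‖f (x - y) - f x‖ₑ ^ j ≤ ENNReal.ofReal η := by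
  have : Fact ((1 : ENNReal) ≤ (j : ENNReal)) := ⟨by exact_mod_cast hj⟩
  have : Fact ((j : ENNReal) ≠ ⊤) := ⟨by simp⟩
  have hc : Continuous (fun y : P =>
      (DomAddAct.mk (-y)) +ᵥ hf.toLp f) := by
    have h0 : Continuous (fun y : P => (DomAddAct.mk (-y), hf.toLp f)) :=
      (DomAddAct.continuous_mk.comp continuous_neg).prodMk continuous_const
    exact (continuous_vadd (M := DomAddAct P) (X := Lp F (j : ENNReal) volume)).comp h0
  have hc0 := Metric.continuousAt_iff.mp (hc.continuousAt (x := 0)) (η ^ (1 / (j:ℝ)))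
    (by positivity)
  obtain ⟨δ, hδ, h⟩ := hc0
  refine ⟨δ, hδ, fun y hy => ?_⟩
  have h1 := h (x := y) (by simpa using hy)
  rw [DomAddAct.mk_vadd_toLp, DomAddAct.mk_vadd_toLp, dist_eq_norm, ← MemLp.toLp_sub,
    Lp.norm_toLp] at h1
  have hj0 : (j:ℝ) ≠ 0 := by positivity
  have h2 : eLpNorm (fun x => f (x - y) - f x) j volume ≤ ENNReal.ofReal (η ^ (1 / (j:ℝ))) := by
    rw [ENNReal.le_ofReal_iff_toReal_le _ (by positivity)]
    · refine le_of_eq_of_le ?_ h1.le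
      congr 2
      funext x
      simp [sub_eq_neg_add]
    · have : MemLp (fun x => f (x - y) - f x) j volume :=
        (hf.comp_measurePreserving (measurePreserving_sub_right volume y)).sub hf
      exact this.2.ne
  rw [eLpNorm_eq_lintegral_rpow_enorm_toReal (by positivity) (by simp)] at h2
  simp only [ENNReal.toReal_natCast, ENNReal.rpow_natCast] at h2
  have h3 := ENNReal.rpow_le_rpow h2 (z := (j:ℝ)) (by positivity)
  rw [← ENNReal.rpow_mul, one_div, inv_mul_cancel₀ hj0, ENNReal.rpow_one,
    ENNReal.ofReal_rpow_of_nonneg (by positivity) (by positivity), ← Real.rpow_mul hη.le,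
    inv_mul_cancel₀ hj0, Real.rpow_one] at h3
  exact h3

lemma FTE.moll {P : Type*} [NormedAddCommGroup P] [NormedSpace ℝ P]
    [FiniteDimensional ℝ P] [MeasureSpace P] [BorelSpace P]
    [(volume : Measure P).IsAddHaarMeasure] {F : Type*} [NormedAddCommGroup F]
    (j : ℕ) (f : P → F)
    (hf : AEStronglyMeasurable f volume) (η δ : ℝ)
    (h : ∀ y : P, ‖y‖ < δ →
      ∫⁻ x, ‖f (x - y) - f x‖ₑ ^ j ≤ ENNReal.ofReal η)
    (ρ : P → ℝ) (hρc : Continuous ρ) (hρ0 : ∀ y, 0 ≤ ρ y)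
    (hρi : Integrable ρ) (hρ1 : ∫ y, ρ y = 1) (hρs : ∀ y, δ ≤ ‖y‖ → ρ y = 0) :
    ∫⁻ p, ∫⁻ y, ENNReal.ofReal (ρ y) * ‖f (p - y) - f p‖ₑ ^ j ≤ ENNReal.ofReal η := by
  rw [lintegral_lintegral_swap]
  · calc ∫⁻ y, ∫⁻ p, ENNReal.ofReal (ρ y) * ‖f (p - y) - f p‖ₑ ^ j 
        ≤ ∫⁻ y, ENNReal.ofReal (ρ y) * ENNReal.ofReal η := by
          apply lintegral_mono
          intro y
          dsimp only
          rw [lintegral_const_mul' _ _ (by simp)]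
          by_cases hy : ‖y‖ < δ
          · gcongr
            exact h y hy
          · simp [hρs y (not_lt.mp hy)]
      _ = ENNReal.ofReal η := by
          rw [lintegral_mul_const' _ _ (by simp), ← ofReal_integral_eq_lintegral_ofReal hρi
            (Filter.Eventually.of_forall hρ0), hρ1]
          simp
  · refine AEMeasurable.mul (f := fun z : P × P => ENNReal.ofReal (ρ z.2))
      (g := fun z : P × P => ‖f (z.1 - z.2) - f z.1‖ₑ ^ j) ?_ ?_
    · exact (hρc.measurable.comp measurable_snd).ennreal_ofReal.aemeasurable
    · apply AEMeasurable.pow_const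
      apply AEStronglyMeasurable.enorm
      apply AEStronglyMeasurable.sub
      · have hq : Measure.QuasiMeasurePreserving
          (fun z : (P) × (P) => z.1 - z.2)
          (volume.prod volume) volume := quasiMeasurePreserving_sub volume volume
        exact hf.comp_quasiMeasurePreserving hq
      · exact hf.comp_fst

set_option linter.unusedSectionVars false
set_option linter.unusedVariables false
section
variable {P : Type*} [NormedAddCommGroup P] [NormedSpace ℝ P]
    [FiniteDimensional ℝ P] [MeasureSpace P] [BorelSpace P]
    [(volume : Measure P).IsAddHaarMeasure]

lemma FTE.deriv_shift (W ψ : P → ℝ) (hW : Integrable W) (hψ : ContDiff ℝ 1 ψ)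
    (L K : ℝ) (hL : ∀ p, ‖fderiv ℝ ψ p‖ ≤ L) (hK : ∀ p, |ψ p| ≤ K) (e : P) (r : ℝ) :
    HasDerivAt (fun r : ℝ => ∫ p, W p * ψ (p + r • e))
      (∫ p, W p * fderiv ℝ ψ (p + r • e) e) r := by
  have hcont : ∀ r : ℝ, Continuous fun p => ψ (p + r • e) := fun r =>
    hψ.continuous.comp (by fun_prop)
  have hcont' : ∀ r : ℝ, Continuous fun p => fderiv ℝ ψ (p + r • e) e := fun r =>
    ((hψ.continuous_fderiv one_ne_zero).comp (by fun_prop)).clm_apply continuous_const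
  refine (hasDerivAt_integral_of_dominated_loc_of_deriv_le (s := univ)
    (bound := fun p => |W p| * (L * ‖e‖))
    (F := fun r p => W p * ψ (p + r • e))
    (F' := fun r p => W p * fderiv ℝ ψ (p + r • e) e) (Filter.univ_mem) ?_ ?_ ?_ ?_ ?_ ?_).2
  · exact Filter.Eventually.of_forall fun r => hW.1.mul (hcont r).aestronglyMeasurable
  · apply hW.mul_bdd (c := K) (hcont r).aestronglyMeasurable
    exact Filter.Eventually.of_forall fun p => hK _
  · exact hW.1.mul (hcont' r).aestronglyMeasurable
  · refine Filter.Eventually.of_forall fun p r _ => ?_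
    rw [norm_mul, Real.norm_eq_abs]
    gcongr
    exact (ContinuousLinearMap.le_opNorm _ _).trans (by gcongr; exact hL _)
  · exact hW.abs.mul_const _
  · refine Filter.Eventually.of_forall fun p r _ => ?_
    apply HasDerivAt.const_mul
    have h1 : HasDerivAt (fun r : ℝ => p + r • e) e r := by
      simpa using ((hasDerivAt_id r).smul_const e).const_add p
    exact ((hψ.differentiable one_ne_zero) (p + r • e)).hasFDerivAt.comp_hasDerivAt r h1

lemma FTE.exists_moll (ε : ℝ) (hε : 0 < ε) : ∃ ρ : P → ℝ, ContDiff ℝ 1 ρ ∧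
    HasCompactSupport ρ ∧ (∀ y, 0 ≤ ρ y) ∧ Integrable ρ ∧ ∫ y, ρ y = 1 ∧
    ∀ y, ε ≤ ‖y‖ → ρ y = 0 := by
  let b : ContDiffBump (0 : P) := ⟨ε / 2, ε, by positivity, by linarith⟩
  refine ⟨b.normed volume, b.contDiff_normed, b.hasCompactSupport_normed, b.nonneg_normed,
    b.integrable_normed, b.integral_normed, fun y hy => ?_⟩
  by_contra h
  have : y ∈ Function.support (b.normed volume) := h
  rw [b.support_normed_eq] at this
  simp [b] at this
  linarith

def FTE.mol (ρ V : P → ℝ) (p : P) : ℝ := ∫ t, V t * ρ (p - t)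

lemma FTE.mol_eq (ρ V : P → ℝ) (p : P) : FTE.mol ρ V p = ∫ y, V (p - y) * ρ y := by
  unfold FTE.mol
  rw [← integral_sub_left_eq_self _ _ p]
  simp

lemma FTE.mol_conv (ρ V : P → ℝ) :
    FTE.mol ρ V = convolution V ρ (ContinuousLinearMap.mul ℝ ℝ) volume := by
  funext p
  rfl

lemma FTE.mol_contDiff (ρ V : P → ℝ) (hV : Integrable V) (hρ : ContDiff ℝ 1 ρ)
    (hρs : HasCompactSupport ρ) : ContDiff ℝ 1 (FTE.mol ρ V) := by
  rw [FTE.mol_conv]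
  exact hρs.contDiff_convolution_right _ hV.locallyIntegrable hρ

lemma FTE.mol_fderiv (ρ V : P → ℝ) (hV : Integrable V) (hρ : ContDiff ℝ 1 ρ)
    (hρs : HasCompactSupport ρ) (p e : P) :
    fderiv ℝ (FTE.mol ρ V) p e = ∫ t, V t * fderiv ℝ ρ (p - t) e := by
  rw [FTE.mol_conv]
  rw [(hρs.hasFDerivAt_convolution_right (ContinuousLinearMap.mul ℝ ℝ) hV.locallyIntegrable
    hρ p).fderiv]
  unfold convolution
  rw [ContinuousLinearMap.integral_apply]
  · rfl
  · have := (hρs.fderiv ℝ).convolutionExists_right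
      ((ContinuousLinearMap.mul ℝ ℝ).precompR P) hV.locallyIntegrable
      (hρ.continuous_fderiv one_ne_zero) p
    exact this

lemma FTE.mol_bd (ρ V : P → ℝ) (hV : Integrable V) (K : ℝ) (hV0 : ∀ p, 0 ≤ V p)
    (hVK : ∀ p, V p ≤ K) (hρi : Integrable ρ)
    (hρ0 : ∀ y, 0 ≤ ρ y) (hρ1 : ∫ y, ρ y = 1) (p : P) :
    0 ≤ FTE.mol ρ V p ∧ FTE.mol ρ V p ≤ K := by
  rw [FTE.mol_eq]
  constructor
  · exact integral_nonneg fun y => mul_nonneg (hV0 _) (hρ0 _)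
  · calc _ ≤ ∫ y, K * ρ y := by
          apply integral_mono_of_nonneg
          · exact Filter.Eventually.of_forall fun y => mul_nonneg (hV0 _) (hρ0 _)
          · exact hρi.const_mul K
          · exact Filter.Eventually.of_forall fun y =>
              mul_le_mul_of_nonneg_right (hVK _) (hρ0 _)
      _ = K := by rw [integral_const_mul, hρ1, mul_one]

lemma FTE.mol_L1 (ρ V : P → ℝ) (hV : Integrable V) (K : ℝ) (hV0 : ∀ p, 0 ≤ V p)
    (hVK : ∀ p, V p ≤ K) (hρc : Continuous ρ) (hρi : Integrable ρ)
    (hρ0 : ∀ y, 0 ≤ ρ y) (hρ1 : ∫ y, ρ y = 1) (δ η : ℝ)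
    (hρs : ∀ y, δ ≤ ‖y‖ → ρ y = 0) (hη : 0 ≤ η)
    (h : ∀ y : P, ‖y‖ < δ →
      ∫⁻ x, ‖V (x - y) - V x‖ₑ ^ 1 ≤ ENNReal.ofReal η) :
    ∫⁻ p, ‖FTE.mol ρ V p - V p‖ₑ ≤ ENNReal.ofReal η := by
  refine le_trans (lintegral_mono fun p => ?_)
    (FTE.moll 1 V hV.1 η δ h ρ hρc hρ0 hρi hρ1 hρs)
  have hi : Integrable fun y => V (p - y) * ρ y := by
    apply hρi.bdd_mul (c := K)
    · exact (hV.comp_sub_left p).1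
    · exact Filter.Eventually.of_forall fun y => by
        rw [Real.norm_of_nonneg (hV0 _)]; exact hVK _
  have h1 : FTE.mol ρ V p - V p = ∫ y, ρ y * (V (p - y) - V p) := by
    rw [FTE.mol_eq]
    have : ∫ y, V p * ρ y = V p := by rw [integral_const_mul, hρ1, mul_one]
    trans (∫ y, V (p - y) * ρ y) - ∫ y, V p * ρ y
    · rw [this]
    rw [← integral_sub hi (hρi.const_mul _)]
    congr 1; funext y; ring
  dsimp only
  rw [h1]
  refine (enorm_integral_le_lintegral_enorm _).trans (le_of_eq ?_)
  congr 1; funext y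
  rw [enorm_mul, pow_one, Real.enorm_eq_ofReal (hρ0 y)]

end

lemma FTE.convex_ineq (a b s : ℝ) (ha : 0 ≤ a) (hb : 0 ≤ b) (hs : 0 < s) :
    (s + 1) * (a ^ s * (b - a)) ≤ b ^ (s + 1) - a ^ (s + 1) := by
  have hy := Real.geom_mean_le_arith_mean2_weighted (w₁ := s / (s + 1)) (w₂ := 1 / (s + 1))
    (p₁ := a ^ (s + 1)) (p₂ := b ^ (s + 1)) (by positivity) (by positivity) (by positivity)
    (by positivity) (by field_simp)
  rw [← Real.rpow_mul ha, ← Real.rpow_mul hb] at hy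
  have e1 : (s + 1) * (s / (s + 1)) = s := by field_simp
  have e2 : (s + 1) * (1 / (s + 1)) = 1 := by field_simp
  rw [e1, e2, Real.rpow_one] at hy
  have e3 : a ^ (s + 1) = a ^ s * a := by
    rw [Real.rpow_add_one' ha (by positivity)]
  have hy' := mul_le_mul_of_nonneg_left hy (show 0 ≤ s + 1 by positivity)
  have e4 : (s + 1) * (s / (s + 1) * a ^ (s + 1) + 1 / (s + 1) * b ^ (s + 1))
    = s * a ^ (s + 1) + b ^ (s + 1) := by field_simp
  rw [e4] at hy'
  rw [e3] at hy' ⊢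
  nlinarith

lemma FTE.pow_lip (a b K : ℝ) (r : ℕ) (ha : 0 ≤ a) (hb : 0 ≤ b) (haK : a ≤ K) (hbK : b ≤ K) :
    |a ^ r - b ^ r| ≤ r * K ^ (r - 1) * |a - b| := by
  have h := abs_pow_sub_pow_le a b r
  refine h.trans ?_
  rw [abs_of_nonneg ha, abs_of_nonneg hb]
  have : max a b ^ (r - 1) ≤ K ^ (r - 1) := by
    apply pow_le_pow_left₀ (le_max_of_le_left ha) (max_le haK hbK)
  calc _ = |a - b| * (r * max a b ^ (r - 1)) := by ring
    _ ≤ |a - b| * (r * K ^ (r - 1)) := by gcongr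
    _ = _ := by ring

structure FTE.LocSol (N : ℕ) (m q B R T C : ℝ) (U : ℝ × EuclideanSpace ℝ (Fin N) → ℝ)
    (G : ℝ × EuclideanSpace ℝ (Fin N) → EuclideanSpace ℝ (Fin N)) : Prop where
  mU : Measurable U
  U0 : ∀ p, 0 ≤ U p
  UC : ∀ p, U p ≤ C
  supp : ∀ p : ℝ × EuclideanSpace ℝ (Fin N), (p.1 ≤ 0 ∨ T ≤ p.1 ∨ R ≤ ‖p.2‖) → U p = 0
  G2 : MemLp G 2 volume
  G1 : Integrable G
  w1 : ∀ ζ : ℝ × EuclideanSpace ℝ (Fin N) → ℝ, ContDiff ℝ 1 ζ →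
    tsupport ζ ⊆ Ioo 0 T ×ˢ Metric.ball 0 (R + 2) → ∀ i : Fin N,
      ∫ p, U p ^ m * fderiv ℝ ζ p (0, EuclideanSpace.single i 1) = - ∫ p, G p i * ζ p
  w2 : ∀ ζ : ℝ × EuclideanSpace ℝ (Fin N) → ℝ, ContDiff ℝ 1 ζ →
    tsupport ζ ⊆ Ioo 0 T ×ˢ Metric.ball 0 (R + 2) →
      ∫ p, (-(U p * fderiv ℝ ζ p (1, 0)) + fderiv ℝ ζ p (0, G p) + B * U p ^ q * ζ p) = 0

lemma FTE.lower_int {α : Type*} [MeasurableSpace α] (μ : Measure α) (F b : α → ℝ) (η : ℝ)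
    (hη : 0 ≤ η) (hF : ∀ p, - b p ≤ F p) (hb : ∫⁻ p, ENNReal.ofReal (b p) ∂μ ≤ ENNReal.ofReal η) :
    - η ≤ ∫ p, F p ∂μ := by
  by_cases hi : Integrable F μ
  · rw [integral_eq_lintegral_pos_part_sub_lintegral_neg_part hi]
    have h1 : ∫⁻ p, ENNReal.ofReal (- F p) ∂μ ≤ ENNReal.ofReal η :=
      (lintegral_mono fun p => ENNReal.ofReal_le_ofReal (by linarith [hF p])).trans hb
    have h2 := ENNReal.toReal_mono (by simp) h1
    rw [ENNReal.toReal_ofReal hη] at h2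
    have h3 : 0 ≤ (∫⁻ p, ENNReal.ofReal (F p) ∂μ).toReal := ENNReal.toReal_nonneg
    linarith
  · rw [integral_undef hi]; linarith

section
variable {P : Type*} [NormedAddCommGroup P] [NormedSpace ℝ P]
    [FiniteDimensional ℝ P] [MeasureSpace P] [BorelSpace P]
    [(volume : Measure P).IsAddHaarMeasure]
    {E : Type*} [NormedAddCommGroup E] [InnerProductSpace ℝ E] [CompleteSpace E]

lemma FTE.D1_bound (G : P → E) (hG1 : Integrable G) (hG2 : MemLp G 2 volume)
    (χ : P → ℝ) (K : ℝ) (hχ0 : ∀ p, 0 ≤ χ p) (hχK : ∀ p, χ p ≤ K)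
    (ρ : P → ℝ) (hρc : Continuous ρ) (hρs' : HasCompactSupport ρ) (hρi : Integrable ρ)
    (hρ0 : ∀ y, 0 ≤ ρ y) (hρ1 : ∫ y, ρ y = 1) (δ η : ℝ) (hη : 0 ≤ η)
    (hρs : ∀ y, δ ≤ ‖y‖ → ρ y = 0) 
    (h : ∀ y : P, ‖y‖ < δ → ∫⁻ x, ‖G (x - y) - G x‖ₑ ^ 2 ≤ ENNReal.ofReal η)
    (z : P) (hz : ‖z‖ < δ) :
    - (2 * K * η) ≤ ∫ p, χ p * inner ℝ (∫ y, ρ y • G (p - y)) (G (p - z)) := by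
  obtain ⟨Kρ, hKρ⟩ := hρs'.exists_bound_of_continuous hρc
  have hK0 : 0 ≤ K := (hχ0 0).trans (hχK 0)
  have hGsq : Integrable fun p => ‖G p‖ ^ 2 := hG2.integrable_norm_pow (by norm_num)
  have hA : ∀ p, Integrable fun y => ρ y * ‖G (p - y) - G p‖ ^ 2 := by
    intro p
    have : Integrable fun y => 2 * (Kρ * ‖G (p - y)‖ ^ 2) + 2 * (‖G p‖ ^ 2 * ρ y) :=
      (((hGsq.comp_sub_left p).const_mul Kρ).const_mul 2).add ((hρi.const_mul _).const_mul _)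
    refine this.mono ?_ ?_
    · exact hρc.aestronglyMeasurable.mul
        ((((hG1.comp_sub_left p).1).sub aestronglyMeasurable_const).norm.pow 2)
    · refine Filter.Eventually.of_forall fun y => ?_
      rw [Real.norm_of_nonneg (mul_nonneg (hρ0 y) (by positivity))]
      refine le_trans ?_ (le_abs_self _)
      have h1 : ‖G (p - y) - G p‖ ^ 2 ≤ 2 * ‖G (p - y)‖ ^ 2 + 2 * ‖G p‖ ^ 2 := by
        have := norm_sub_le (G (p - y)) (G p)
        have h0 := norm_nonneg (G (p - y) - G p)
        nlinarith [sq_nonneg (‖G (p - y)‖ - ‖G p‖)]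
      have h2 : ρ y ≤ Kρ := (le_abs_self _).trans (hKρ y)
      have h3 := mul_le_mul_of_nonneg_left h1 (hρ0 y)
      have h4 := mul_le_mul_of_nonneg_right h2 (sq_nonneg ‖G (p - y)‖)
      nlinarith
  have hB : ∀ p, Integrable fun y => ρ y • G (p - y) := by
    intro p
    apply (hG1.comp_sub_left p).bdd_smul Kρ hρc.aestronglyMeasurable
    exact Filter.Eventually.of_forall hKρ
  apply FTE.lower_int _ _ (fun p => K * ((∫ y, ρ y * ‖G (p - y) - G p‖ ^ 2) +
    ‖G (p - z) - G p‖ ^ 2)) _ (by positivity)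
  · intro p
    have h1 : - ((∫ y, ρ y * ‖G (p - y) - G p‖ ^ 2) + ‖G (p - z) - G p‖ ^ 2) ≤
        inner ℝ (∫ y, ρ y • G (p - y)) (G (p - z)) := by
      rw [real_inner_comm, ← integral_inner (hB p)]
      have h2 : ‖G (p - z) - G p‖ ^ 2 = ∫ y, ρ y * ‖G (p - z) - G p‖ ^ 2 := by
        rw [integral_mul_const, hρ1, one_mul]
      rw [h2, ← integral_add (hA p) (hρi.mul_const _), ← integral_neg]
      apply integral_mono ((hA p).add (hρi.mul_const _)).neg ((hB p).const_inner _)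
      intro y
      simp only [Pi.neg_apply, Pi.add_apply]
      rw [inner_smul_right]
      have h3 := norm_sub_sq_real (G (p - z)) (G (p - y))
      have h4 : ‖G (p - z) - G (p - y)‖ ^ 2 ≤
          2 * ‖G (p - y) - G p‖ ^ 2 + 2 * ‖G (p - z) - G p‖ ^ 2 := by
        have := norm_sub_le (G (p - z) - G p) (G (p - y) - G p)
        rw [sub_sub_sub_cancel_right] at this
        have h0 := norm_nonneg (G (p - z) - G (p - y))
        nlinarith [sq_nonneg (‖G (p - y) - G p‖ - ‖G (p - z) - G p‖)]
      have h5 : - (‖G (p - y) - G p‖ ^ 2 + ‖G (p - z) - G p‖ ^ 2) ≤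
          inner ℝ (G (p - z)) (G (p - y)) := by
        nlinarith [sq_nonneg ‖G (p - z)‖, sq_nonneg ‖G (p - y)‖]
      nlinarith [mul_le_mul_of_nonneg_left h5 (hρ0 y)]
    have hS : 0 ≤ (∫ y, ρ y * ‖G (p - y) - G p‖ ^ 2) + ‖G (p - z) - G p‖ ^ 2 :=
      add_nonneg (integral_nonneg fun y => mul_nonneg (hρ0 y) (by positivity)) (by positivity)
    have h6 := mul_le_mul_of_nonneg_left h1 (hχ0 p)
    have h7 := mul_le_mul_of_nonneg_right (hχK p) hS
    nlinarith
  · have e1 : ∀ p, ENNReal.ofReal (K * ((∫ y, ρ y * ‖G (p - y) - G p‖ ^ 2) +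
        ‖G (p - z) - G p‖ ^ 2)) = ENNReal.ofReal K *
        ((∫⁻ y, ENNReal.ofReal (ρ y) * ‖G (p - y) - G p‖ₑ ^ 2) + ‖G (p - z) - G p‖ₑ ^ 2) := by
      intro p
      rw [ENNReal.ofReal_mul hK0, ENNReal.ofReal_add (integral_nonneg fun y =>
        mul_nonneg (hρ0 y) (by positivity)) (by positivity),
        ofReal_integral_eq_lintegral_ofReal (hA p) (Filter.Eventually.of_forall fun y =>
        mul_nonneg (hρ0 y) (by positivity))]
      congr 2
      · congr 1; funext y
        rw [ENNReal.ofReal_mul (hρ0 y), ENNReal.ofReal_pow (by positivity), ofReal_norm]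
      · rw [ENNReal.ofReal_pow (by positivity), ofReal_norm]
    simp_rw [e1]
    rw [lintegral_const_mul' _ _ (by simp), lintegral_add_right']
    · have hm := FTE.moll 2 G hG1.1 η δ h ρ hρc hρ0 hρi hρ1 hρs
      calc _ ≤ ENNReal.ofReal K * (ENNReal.ofReal η + ENNReal.ofReal η) := by
            gcongr
            exact h z hz
        _ = _ := by
            rw [← ENNReal.ofReal_add hη hη, ← ENNReal.ofReal_mul hK0]
            congr 1; ring
    · apply AEMeasurable.pow_const
      exact ((hG1.comp_sub_right z).1.sub hG1.1).enorm

end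

abbrev FTE.PS (N : ℕ) := ℝ × EuclideanSpace ℝ (Fin N)

section
variable {N : ℕ} {m q B R T C : ℝ} {U : FTE.PS N → ℝ} {G : FTE.PS N → EuclideanSpace ℝ (Fin N)}

lemma FTE.intU (h : FTE.LocSol N m q B R T C U G) (W : FTE.PS N → ℝ) (hW : Measurable W)
    (K : ℝ) (hK : ∀ p, |W p| ≤ K)
    (hs : ∀ p : FTE.PS N, (p.1 ≤ 0 ∨ T ≤ p.1 ∨ R ≤ ‖p.2‖) → W p = 0) : Integrable W := by
  have hfin : volume (Icc (0:ℝ) T ×ˢ Metric.closedBall (0 : EuclideanSpace ℝ (Fin N)) R) < ⊤ :=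
    (isCompact_Icc.prod (isCompact_closedBall _ _)).measure_lt_top
  have h1 : IntegrableOn W (Icc (0:ℝ) T ×ˢ Metric.closedBall (0 : EuclideanSpace ℝ (Fin N)) R) :=
    Measure.integrableOn_of_bounded hfin.ne hW.aestronglyMeasurable
      (M := K) (Filter.Eventually.of_forall hK)
  refine h1.integrable_of_forall_notMem_eq_zero fun p hp => ?_
  apply hs
  by_contra hc
  push Not at hc
  apply hp
  exact ⟨⟨hc.1.le, hc.2.1.le⟩, by simpa using hc.2.2.le⟩

lemma FTE.intUpow (h : FTE.LocSol N m q B R T C U G) (k : ℝ) (hk : 0 < k) :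
    Integrable (fun p => U p ^ k) ∧ (∀ p, 0 ≤ U p ^ k) ∧ (∀ p, U p ^ k ≤ C ^ k) ∧
    ∀ p : FTE.PS N, (p.1 ≤ 0 ∨ T ≤ p.1 ∨ R ≤ ‖p.2‖) → U p ^ k = 0 := by
  have h0 : ∀ p, 0 ≤ U p ^ k := fun p => Real.rpow_nonneg (h.U0 p) _
  have h1 : ∀ p, U p ^ k ≤ C ^ k := fun p => Real.rpow_le_rpow (h.U0 p) (h.UC p) hk.le
  have h2 : ∀ p : FTE.PS N, (p.1 ≤ 0 ∨ T ≤ p.1 ∨ R ≤ ‖p.2‖) → U p ^ k = 0 := fun p hp => by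
    rw [h.supp p hp, Real.zero_rpow hk.ne']
  refine ⟨FTE.intU h _ (h.mU.pow_const k) (C ^ k) (fun p => ?_) h2, h0, h1, h2⟩
  rw [abs_of_nonneg (h0 p)]; exact h1 p

lemma FTE.mol_zero (ρ V : FTE.PS N → ℝ) (ε : ℝ) (hρs : ∀ y, ε ≤ ‖y‖ → ρ y = 0)
    (hV : ∀ p : FTE.PS N, R ≤ ‖p.2‖ → V p = 0) (p : FTE.PS N) (hp : R + ε ≤ ‖p.2‖) :
    FTE.mol ρ V p = 0 := by
  rw [FTE.mol_eq]
  rw [integral_eq_zero_of_ae]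
  refine Filter.Eventually.of_forall fun y => ?_
  by_cases hy : ε ≤ ‖y‖
  · simp [hρs y hy]
  · have h1 : ‖y.2‖ ≤ ‖y‖ := norm_snd_le y
    have h2 : R ≤ ‖(p - y).2‖ := by
      have := norm_sub_norm_le p.2 y.2
      simp only [Prod.snd_sub]
      linarith
    simp [hV _ h2]

lemma FTE.grad_mol (h : FTE.LocSol N m q B R T C U G) (hm : 1 ≤ m) (ρ : FTE.PS N → ℝ)
    (hρ : ContDiff ℝ 1 ρ) (hρc : HasCompactSupport ρ) (ε a b : ℝ)
    (hρs : ∀ y, ε ≤ ‖y‖ → ρ y = 0) (hε1 : ε ≤ 1) (hεa : ε < a) (hεb : ε < T - b)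
    (p : FTE.PS N) (hp1 : p.1 ∈ Icc a b) (hp2 : ‖p.2‖ < R + ε)
    (w : EuclideanSpace ℝ (Fin N)) :
    fderiv ℝ (FTE.mol ρ (fun p => U p ^ m)) p (0, w) = inner ℝ (∫ y, ρ y • G (p - y)) w := by
  obtain ⟨hVi, -, -, -⟩ := FTE.intUpow h m (by linarith)
  obtain ⟨Kρ, hKρ⟩ := hρc.exists_bound_of_continuous hρ.continuous
  have hB : Integrable fun y => ρ y • G (p - y) := by
    apply (h.G1.comp_sub_left p).bdd_smul Kρ hρ.continuous.aestronglyMeasurable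
    exact Filter.Eventually.of_forall hKρ
  set ζ : FTE.PS N → ℝ := fun t => ρ (p - t) with hζ
  have hζd : ContDiff ℝ 1 ζ := hρ.comp (contDiff_const.sub contDiff_id)
  have hζs : tsupport ζ ⊆ Ioo 0 T ×ˢ Metric.ball 0 (R + 2) := by
    have h1 : tsupport ζ ⊆ Metric.closedBall p ε := by
      apply closure_minimal _ Metric.isClosed_closedBall
      intro t ht
      by_contra hc
      apply ht
      apply hρs
      rw [Metric.mem_closedBall, dist_eq_norm, norm_sub_rev] at hc
      exact (not_le.mp hc).le
    intro t ht
    have h2 := h1 ht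
    rw [Metric.mem_closedBall, dist_eq_norm] at h2
    have h3 := (norm_fst_le (t - p)).trans h2
    have h4 := (norm_snd_le (t - p)).trans h2
    simp only [Prod.fst_sub, Prod.snd_sub, Real.norm_eq_abs, abs_le] at h3 h4
    have h5 := norm_sub_norm_le t.2 p.2
    refine ⟨⟨?_, ?_⟩, ?_⟩
    · linarith [hp1.1]
    · linarith [hp1.2]
    · rw [mem_ball_zero_iff]; linarith
  have hcomp : ∀ i : Fin N, fderiv ℝ (FTE.mol ρ (fun p => U p ^ m)) p
      (0, EuclideanSpace.single i 1) = (∫ y, ρ y • G (p - y)) i := by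
    intro i
    rw [FTE.mol_fderiv ρ _ hVi hρ hρc]
    have h1 : ∀ t, fderiv ℝ ζ t (0, EuclideanSpace.single i 1) =
        - fderiv ℝ ρ (p - t) (0, EuclideanSpace.single i 1) := by
      intro t
      have h2 : HasFDerivAt ζ ((fderiv ℝ ρ (p - t)).comp
          (-(ContinuousLinearMap.id ℝ (FTE.PS N)))) t := by
        apply ((hρ.differentiable one_ne_zero) (p - t)).hasFDerivAt.comp t
        exact (hasFDerivAt_id t).const_sub p
      rw [h2.fderiv]
      simp
    have h3 := h.w1 ζ hζd hζs i
    simp_rw [h1, mul_neg, integral_neg] at h3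
    rw [neg_inj] at h3
    rw [h3]
    have h4 : (∫ y, ρ y • G (p - y)) i = ∫ y, (ρ y • G (p - y)) i :=
      ((EuclideanSpace.proj (𝕜 := ℝ) i).integral_comp_comm hB).symm
    rw [h4, ← integral_sub_left_eq_self _ _ p]
    congr 1; funext t
    simp [hζ, mul_comm]
  have hw : ((0 : ℝ), w) = ∑ i, (w i) • ((0 : ℝ), EuclideanSpace.single i (1:ℝ)) := by
    ext1
    · simp [Prod.fst_sum]
    · simp only [Prod.snd_sum, Prod.smul_snd]
      ext j
      simp [Pi.single_apply]
  rw [hw, map_sum]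
  simp_rw [map_smul, hcomp]
  simp [PiLp.inner_apply]

lemma FTE.psi_facts (h : FTE.LocSol N m q B R T C U G) (hm : 1 ≤ m) (ρ : FTE.PS N → ℝ)
    (hρ : ContDiff ℝ 1 ρ) (hρc : HasCompactSupport ρ) (ε a b : ℝ)
    (hρs : ∀ y, ε ≤ ‖y‖ → ρ y = 0) (hε1 : ε ≤ 1) (hεa : ε < a) (hεb : ε < T - b)
    (φ : ℝ → ℝ) (hφ : ContDiff ℝ 1 φ) (hφs : ∀ t, t ∉ Icc a b → φ t = 0)
    (r : ℕ) (hr : 2 ≤ r) (ψ : FTE.PS N → ℝ)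
    (hψ : ψ = fun p => φ p.1 * FTE.mol ρ (fun p => U p ^ m) p ^ r) :
    ContDiff ℝ 1 ψ ∧ Function.support ψ ⊆ Icc a b ×ˢ Metric.closedBall 0 (R + 1) ∧
    ∀ p w, fderiv ℝ ψ p (0, w) =
      (φ p.1 * (r * FTE.mol ρ (fun p => U p ^ m) p ^ (r - 1))) *
        inner ℝ (∫ y, ρ y • G (p - y)) w := by
  obtain ⟨hVi, -, -, hVs⟩ := FTE.intUpow h m (by linarith)
  have hvc := FTE.mol_contDiff ρ _ hVi hρ hρc
  have hz := FTE.mol_zero (R := R) ρ (fun p => U p ^ m) ε hρs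
    (fun p hp => hVs p (Or.inr (Or.inr hp)))
  refine ⟨?_, ?_, ?_⟩
  · rw [hψ]
    exact (hφ.comp contDiff_fst).mul (hvc.pow r)
  · intro p hp
    rw [hψ] at hp
    constructor
    · by_contra hc
      apply hp
      simp [hφs _ hc]
    · rw [mem_closedBall_zero_iff]
      by_contra hc
      apply hp
      simp only
      rw [hz p (by linarith), zero_pow (by omega), mul_zero]
  · intro p w
    have hd : HasFDerivAt ψ ((φ p.1) • ((r * FTE.mol ρ (fun p => U p ^ m) p ^ (r - 1)) •
        fderiv ℝ (FTE.mol ρ (fun p => U p ^ m)) p) +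
        (FTE.mol ρ (fun p => U p ^ m) p ^ r) •
        ((fderiv ℝ φ p.1).comp (ContinuousLinearMap.fst ℝ ℝ (EuclideanSpace ℝ (Fin N))))) p := by
      rw [hψ]
      apply HasFDerivAt.mul
      · exact ((hφ.differentiable one_ne_zero) p.1).hasFDerivAt.comp p hasFDerivAt_fst
      · have := ((hvc.differentiable one_ne_zero) p).hasFDerivAt.pow r
        simpa using this
    rw [hd.fderiv]
    simp only [_root_.add_apply, _root_.smul_apply,
      ContinuousLinearMap.comp_apply, ContinuousLinearMap.coe_fst', map_zero,
      smul_eq_mul]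
    by_cases hp1 : p.1 ∈ Icc a b
    · by_cases hp2 : ‖p.2‖ < R + ε
      · rw [FTE.grad_mol h hm ρ hρ hρc ε a b hρs hε1 hεa hεb p hp1 hp2 w]
        ring
      · rw [hz p (not_lt.mp hp2), zero_pow (by omega)]
        simp
    · rw [hφs _ hp1]; simp

end

section
variable {N : ℕ} {m q B R T C : ℝ} {U : FTE.PS N → ℝ} {G : FTE.PS N → EuclideanSpace ℝ (Fin N)}

lemma FTE.int_close {α : Type*} [MeasurableSpace α] {μ : Measure α} (f d : α → ℝ) (K κ : ℝ)
    (hK : 0 ≤ K) (hf : ∀ p, |f p| ≤ K) (hd : Integrable d μ) (hκ : ∫ p, |d p| ∂μ ≤ κ) :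
    |∫ p, f p * d p ∂μ| ≤ K * κ := by
  have h1 : ‖∫ p, f p * d p ∂μ‖ ≤ ∫ p, K * |d p| ∂μ := by
    apply norm_integral_le_of_norm_le (hd.abs.const_mul K)
    refine Filter.Eventually.of_forall fun p => ?_
    rw [norm_mul]
    exact mul_le_mul_of_nonneg_right (hf p) (abs_nonneg _)
  rw [integral_const_mul] at h1
  exact h1.trans (mul_le_mul_of_nonneg_left hκ hK)

lemma FTE.int_abs_le {α : Type*} [MeasurableSpace α] {μ : Measure α} (d : α → ℝ) (κ : ℝ)
    (hκ0 : 0 ≤ κ) (hκ : ∫⁻ p, ‖d p‖ₑ ∂μ ≤ ENNReal.ofReal κ) :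
    ∫ p, |d p| ∂μ ≤ κ := by
  by_cases hi : Integrable (fun p => |d p|) μ
  · rw [integral_eq_lintegral_of_nonneg_ae (Filter.Eventually.of_forall fun p => abs_nonneg _) hi.1]
    apply ENNReal.toReal_le_of_le_ofReal hκ0
    refine le_of_eq_of_le ?_ hκ
    congr 1; funext p
    rw [← ofReal_norm, Real.norm_eq_abs]
  · rw [integral_undef hi]; exact hκ0

set_option maxHeartbeats 1000000 in
lemma FTE.energy_step (h : FTE.LocSol N m q B R T C U G) (hm : 1 ≤ m) (hq : 0 < q) (hB : 0 < B)
    (hC : 0 ≤ C)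
    (ρ : FTE.PS N → ℝ)
    (hρ : ContDiff ℝ 1 ρ) (hρc : HasCompactSupport ρ) (hρ0 : ∀ y, 0 ≤ ρ y) (hρi : Integrable ρ)
    (hρ1 : ∫ y, ρ y = 1) (δ a b : ℝ)
    (hρs : ∀ y, δ ≤ ‖y‖ → ρ y = 0) (hε1 : δ ≤ 1) (hεa : δ < a) (hεb : δ < T - b)
    (φ : ℝ → ℝ) (hφ : ContDiff ℝ 1 φ) (hφs : ∀ t, t ∉ Icc a b → φ t = 0)
    (Kφ : ℝ) (hφ0 : ∀ t, 0 ≤ φ t) (hφK : ∀ t, φ t ≤ Kφ)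
    (r : ℕ) (hr : 2 ≤ r) (h0 : ℝ) (hh0 : 0 < h0) (hh0δ : h0 < δ)
    (η η' : ℝ) (hη : 0 ≤ η) (hη' : 0 ≤ η')
    (hGt : ∀ y : FTE.PS N, ‖y‖ < δ → ∫⁻ x, ‖G (x - y) - G x‖ₑ ^ 2 ≤ ENNReal.ofReal η)
    (hUt : ∀ y : FTE.PS N, ‖y‖ < δ → ∫⁻ x, ‖U (x - y) ^ q - U x ^ q‖ₑ ^ 1 ≤ ENNReal.ofReal η)
    (hVm : ∫⁻ p, ‖FTE.mol ρ (fun p => U p ^ m) p - U p ^ m‖ₑ ≤ ENNReal.ofReal η')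
    (K1 Kψ κ : ℝ) (hK1 : K1 = Kφ * (r * (C ^ m) ^ (r - 1))) (hKψ : Kψ = Kφ * (C ^ m) ^ r)
    (hκ : κ = K1 * η') :
    h0 * (B * (∫ p, φ p.1 * U p ^ (m * r + q)) - 2 * K1 * η - B * (Kψ * η + C ^ q * κ))
      ≤ 1 / (m * r + 1) * ((∫ p, U p ^ (m * r + 1) * φ (p.1 + h0)) -
          ∫ p, U p ^ (m * r + 1) * φ p.1) + C * κ := by
  have hr0 : (0:ℝ) < r := by positivity
  have hmr : 0 < m * r := by positivity
  have hKφ : 0 ≤ Kφ := (hφ0 0).trans (hφK 0)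
  have hCm : 0 ≤ C ^ m := Real.rpow_nonneg hC _
  have hK1' : 0 ≤ K1 := by rw [hK1]; positivity
  have hKψ' : 0 ≤ Kψ := by rw [hKψ]; positivity
  have hCq : 0 ≤ C ^ q := Real.rpow_nonneg hC _
  obtain ⟨hVi, hV0, hVC, hVs⟩ := FTE.intUpow h m (by linarith)
  obtain ⟨hQi, hQ0, hQC, hQs⟩ := FTE.intUpow h q hq
  obtain ⟨hSi, hS0, hSC, hSs⟩ := FTE.intUpow h (m * r) hmr
  obtain ⟨hS1i, hS10, hS1C, hS1s⟩ := FTE.intUpow h (m * r + 1) (by linarith)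
  have hUi : Integrable U := by
    have := (FTE.intUpow h 1 one_pos).1
    simpa using this
  set v := FTE.mol ρ (fun p => U p ^ m) with hv
  have hvb : ∀ p, 0 ≤ v p ∧ v p ≤ C ^ m := FTE.mol_bd ρ _ hVi _ hV0 hVC hρi hρ0 hρ1
  have hvc : ContDiff ℝ 1 v := FTE.mol_contDiff ρ _ hVi hρ hρc
  set ψ : FTE.PS N → ℝ := fun p => φ p.1 * v p ^ r with hψ
  obtain ⟨hψd, hψs, hψg⟩ := FTE.psi_facts h hm ρ hρ hρc δ a b hρs hε1 hεa hεb φ hφ hφs r hr ψ hψ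
  have hψc : HasCompactSupport ψ := by
    apply HasCompactSupport.intro (isCompact_Icc.prod (isCompact_closedBall _ _))
    intro p hp
    by_contra hc
    exact hp (hψs hc)
  have hψi : Integrable ψ := hψd.continuous.integrable_of_hasCompactSupport hψc
  have hψ0 : ∀ p, 0 ≤ ψ p := fun p => mul_nonneg (hφ0 _) (pow_nonneg (hvb p).1 _)
  have hψK : ∀ p, |ψ p| ≤ Kψ := fun p => by
    rw [abs_of_nonneg (hψ0 p), hKψ]
    exact mul_le_mul (hφK _) (pow_le_pow_left₀ (hvb p).1 (hvb p).2 _)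
      (pow_nonneg (hvb p).1 _) hKφ
  obtain ⟨L, hL⟩ := (hψc.fderiv ℝ).exists_bound_of_continuous (hψd.continuous_fderiv one_ne_zero)
  set e : FTE.PS N := (1, 0) with he
  have hen : ∀ τ : ℝ, ‖τ • e‖ = |τ| := fun τ => by
    rw [norm_smul, he, Prod.norm_def]; simp
  have hφm : Measurable φ := hφ.continuous.measurable
  have hφb : ∀ t, ‖φ t‖ ≤ Kφ := fun t => by
    rw [Real.norm_of_nonneg (hφ0 _)]; exact hφK _
  -- the difference d
  set d : FTE.PS N → ℝ := fun p => ψ p - φ p.1 * U p ^ (m * r) with hd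
  have hφSi : Integrable fun p : FTE.PS N => φ p.1 * U p ^ (m * r) := by
    apply hSi.bdd_mul (c := Kφ) (hφm.comp measurable_fst).aestronglyMeasurable
    exact Filter.Eventually.of_forall fun p => hφb _
  have hdi : Integrable d := hψi.sub hφSi
  have hvVi : Integrable (fun p => v p - U p ^ m) :=
    ⟨hvc.continuous.aestronglyMeasurable.sub hVi.1, lt_of_le_of_lt hVm (by simp)⟩
  have hdκ : ∫ p, |d p| ≤ κ := by
    have h1 : ∫ p, |v p - U p ^ m| ≤ η' := FTE.int_abs_le _ _ hη' hVm
    calc ∫ p, |d p| ≤ ∫ p, K1 * |v p - U p ^ m| := by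
          apply integral_mono hdi.abs (hvVi.abs.const_mul _)
          intro p
          simp only [hd, hψ]
          rw [Real.rpow_mul_natCast (h.U0 p), ← mul_sub, abs_mul, abs_of_nonneg (hφ0 _), hK1,
            mul_assoc]
          have h2 := FTE.pow_lip (v p) (U p ^ m) (C ^ m) r (hvb p).1 (hV0 p) (hvb p).2 (hVC p)
          exact mul_le_mul (hφK _) h2 (abs_nonneg _) hKφ
      _ ≤ κ := by
          rw [integral_const_mul, hκ]
          exact mul_le_mul_of_nonneg_left h1 hK1'
  set H : ℝ → ℝ := fun τ => ∫ p, U p * ψ (p + τ • e) with hH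
  have hHd : ∀ τ, HasDerivAt H (∫ p, U p * fderiv ℝ ψ (p + τ • e) e) τ := fun τ =>
    FTE.deriv_shift U ψ hUi hψd L Kψ hL hψK e τ
  set dlow := B * (∫ p, φ p.1 * U p ^ (m * r + q)) - 2 * K1 * η - B * (Kψ * η + C ^ q * κ)
    with hdlow
  have hlow : ∀ τ ∈ Icc 0 h0, dlow ≤ ∫ p, U p * fderiv ℝ ψ (p + τ • e) e := by
    intro τ hτ
    have hτδ : ‖τ • e‖ < δ := by
      rw [hen, abs_of_nonneg hτ.1]; linarith [hτ.2]
    -- apply the weak formulation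
    set ψτ : FTE.PS N → ℝ := fun p => ψ (p + τ • e) with hψτ
    have hψτd : ContDiff ℝ 1 ψτ := hψd.comp (contDiff_id.add contDiff_const)
    have hψτs : tsupport ψτ ⊆ Ioo 0 T ×ˢ Metric.ball 0 (R + 2) := by
      have h1 : tsupport ψτ ⊆ (fun p => p + τ • e) ⁻¹' (Icc a b ×ˢ Metric.closedBall 0 (R + 1)) := by
        apply closure_minimal
        · intro p hp
          exact hψs hp
        · exact (isClosed_Icc.prod Metric.isClosed_closedBall).preimage (by fun_prop)
      intro p hp
      obtain ⟨h2, h3⟩ := h1 hp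
      simp only [he, Prod.fst_add, Prod.smul_fst, smul_eq_mul, mul_one, Prod.snd_add,
        Prod.smul_snd, smul_zero, add_zero, mem_closedBall_zero_iff] at h2 h3
      refine ⟨⟨by linarith [h2.1, hτ.2], ?_⟩, ?_⟩
      · have := norm_nonneg (τ • e)
        linarith [h2.2, hτ.1]
      · rw [mem_ball_zero_iff]; linarith
    have hw := h.w2 ψτ hψτd hψτs
    have hfd : ∀ p, fderiv ℝ ψτ p = fderiv ℝ ψ (p + τ • e) := fun p =>
      fderiv_comp_add_right (τ • e)
    simp_rw [hfd] at hw
    have hfc : Continuous fun p => fderiv ℝ ψ (p + τ • e) :=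
      (hψd.continuous_fderiv one_ne_zero).comp (by fun_prop)
    have i1 : Integrable fun p => U p * fderiv ℝ ψ (p + τ • e) (1, 0) := by
      apply hUi.mul_bdd (c := L * ‖e‖) (hfc.clm_apply continuous_const).aestronglyMeasurable
      exact Filter.Eventually.of_forall fun p => by
        refine (ContinuousLinearMap.le_opNorm _ _).trans ?_
        exact mul_le_mul_of_nonneg_right (hL _) (norm_nonneg _)
    have i2 : Integrable fun p => fderiv ℝ ψ (p + τ • e) (0, G p) := by
      refine (h.G1.norm.const_mul L).mono ?_ ?_
      · have hG' : AEStronglyMeasurable (fun p => ((0:ℝ), G p)) volume :=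
          (aestronglyMeasurable_const.prodMk h.G1.1)
        exact (ContinuousLinearMap.id ℝ (FTE.PS N →L[ℝ] ℝ)).aestronglyMeasurable_comp₂
          hfc.aestronglyMeasurable hG'
      · refine Filter.Eventually.of_forall fun p => ?_
        refine (ContinuousLinearMap.le_opNorm _ _).trans ?_
        refine le_trans ?_ (le_abs_self _)
        rw [Prod.norm_mk, norm_zero, max_eq_right (norm_nonneg _)]
        exact mul_le_mul_of_nonneg_right (hL _) (norm_nonneg _)
    have i3 : Integrable fun p => B * U p ^ q * ψτ p := by
      apply (hQi.const_mul B).mul_bdd (c := Kψ) hψτd.continuous.aestronglyMeasurable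
      exact Filter.Eventually.of_forall fun p => hψK _
    have hneg : Integrable (fun p => -(U p * fderiv ℝ ψ (p + τ • e) (1,0))) := i1.neg
    have i12 : Integrable (fun p => -(U p * fderiv ℝ ψ (p + τ • e) (1,0)) +
        fderiv ℝ ψ (p + τ • e) (0, G p)) := hneg.add i2
    rw [integral_add i12 i3, integral_add hneg i2, integral_neg] at hw
    have s2 : ∫ p, fderiv ℝ ψ (p + τ • e) (0, G p) = ∫ p, (φ p.1 * (r * v p ^ (r - 1))) *
        inner ℝ (∫ y, ρ y • G (p - y)) (G (p - τ • e)) := by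
      rw [← integral_sub_right_eq_self _ (τ • e)]
      congr 1; funext p
      rw [sub_add_cancel, hψg]
    have b2 := FTE.D1_bound G h.G1 h.G2 (fun p => φ p.1 * (r * v p ^ (r - 1))) K1
      (fun p => mul_nonneg (hφ0 _) (mul_nonneg hr0.le (pow_nonneg (hvb p).1 _)))
      (fun p => by
        rw [hK1]
        exact mul_le_mul (hφK _) (mul_le_mul_of_nonneg_left
          (pow_le_pow_left₀ (hvb p).1 (hvb p).2 _) hr0.le)
          (mul_nonneg hr0.le (pow_nonneg (hvb p).1 _)) hKφ)
      ρ hρ.continuous hρc hρi hρ0 hρ1 δ η hη hρs hGt (τ • e) hτδ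
    rw [← s2] at b2
    have s3 : ∫ p, B * U p ^ q * ψτ p = B * ∫ p, U (p - τ • e) ^ q * ψ p := by
      rw [← integral_sub_right_eq_self _ (τ • e), ← integral_const_mul]
      congr 1; funext p
      simp only [hψτ]
      rw [sub_add_cancel]; ring
    have hQi' : Integrable fun p => U (p - τ • e) ^ q := hQi.comp_sub_right (τ • e)
    have s4 : ∫ p, U (p - τ • e) ^ q * ψ p = (∫ p, φ p.1 * U p ^ (m * r + q)) +
        (∫ p, ψ p * (U (p - τ • e) ^ q - U p ^ q)) + ∫ p, U p ^ q * d p := by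
      have j1 : Integrable fun p => ψ p * (U (p - τ • e) ^ q - U p ^ q) := by
        apply (hQi'.sub hQi).bdd_mul (c := Kψ) hψd.continuous.aestronglyMeasurable
        exact Filter.Eventually.of_forall fun p => hψK _
      have j2 : Integrable fun p => U p ^ q * d p := by
        apply hdi.bdd_mul (c := C ^ q) hQi.1
        exact Filter.Eventually.of_forall fun p => by
          rw [Real.norm_of_nonneg (hQ0 _)]; exact hQC _
      have j3 : Integrable fun p : FTE.PS N => φ p.1 * U p ^ (m * r + q) := by
        apply (FTE.intUpow h (m * r + q) (by linarith)).1.bdd_mul (c := Kφ)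
          (hφm.comp measurable_fst).aestronglyMeasurable
        exact Filter.Eventually.of_forall fun p => hφb _
      have j31 : Integrable fun p : FTE.PS N => φ p.1 * U p ^ (m * r + q) +
          ψ p * (U (p - τ • e) ^ q - U p ^ q) := j3.add j1
      rw [← integral_add j3 j1, ← integral_add j31 j2]
      congr 1; funext p
      simp only [hd]
      rw [Real.rpow_add_of_nonneg (h.U0 p) hmr.le hq.le]
      ring
    have b3 := FTE.int_close ψ (fun p => U (p - τ • e) ^ q - U p ^ q) Kψ η hKψ' hψK
      (hQi'.sub hQi) (FTE.int_abs_le _ _ hη (by simpa using hUt _ hτδ))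
    have b4 := FTE.int_close (fun p => U p ^ q) d (C ^ q) κ hCq
      (fun p => by rw [abs_of_nonneg (hQ0 _)]; exact hQC _) hdi hdκ
    rw [abs_le] at b3 b4
    have b5 := mul_le_mul_of_nonneg_left (show (∫ p, φ p.1 * U p ^ (m * r + q)) -
      (Kψ * η + C ^ q * κ) ≤ ∫ p, U (p - τ • e) ^ q * ψ p by rw [s4]; linarith [b3.1, b4.1]) hB.le
    rw [← s3] at b5
    rw [hdlow]
    change _ ≤ ∫ p, U p * fderiv ℝ ψ (p + τ • e) (1, 0)
    nlinarith
  have hmvt : dlow * (h0 - 0) ≤ H h0 - H 0 := by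
    apply (convex_Icc 0 h0).mul_sub_le_image_sub_of_le_deriv
      (fun τ _ => (hHd τ).continuousAt.continuousWithinAt)
      (fun τ _ => (hHd τ).differentiableAt.differentiableWithinAt)
      (fun τ hτ => by
        rw [(hHd τ).deriv]
        exact hlow τ (interior_subset hτ))
    · exact ⟨le_rfl, hh0.le⟩
    · exact ⟨hh0.le, le_rfl⟩
    · exact hh0.le
  have hUi' : Integrable fun p => U (p - h0 • e) := hUi.comp_sub_right (h0 • e)
  have hS1i' : Integrable fun p => U (p - h0 • e) ^ (m * r + 1) := hS1i.comp_sub_right (h0 • e)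
  have k1 : Integrable fun p => U (p - h0 • e) * ψ p := by
    apply hUi'.mul_bdd (c := Kψ) hψd.continuous.aestronglyMeasurable
    exact Filter.Eventually.of_forall fun p => hψK _
  have k2 : Integrable fun p => U p * ψ p := by
    apply hUi.mul_bdd (c := Kψ) hψd.continuous.aestronglyMeasurable
    exact Filter.Eventually.of_forall fun p => hψK _
  have hdiffK : ∀ p, |U (p - h0 • e) - U p| ≤ C := fun p => by
    rw [abs_le]
    constructor
    · linarith [h.U0 (p - h0 • e), h.UC p]
    · linarith [h.UC (p - h0 • e), h.U0 p]
  have k3 : Integrable fun p => (U (p - h0 • e) - U p) * d p := by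
    apply hdi.bdd_mul (c := C) (hUi'.sub hUi).1
    exact Filter.Eventually.of_forall fun p => hdiffK p
  have k4 : Integrable fun p => (U (p - h0 • e) - U p) * (φ p.1 * U p ^ (m * r)) := by
    apply hφSi.bdd_mul (c := C) (hUi'.sub hUi).1
    exact Filter.Eventually.of_forall fun p => hdiffK p
  have e1 : H h0 - H 0 = (∫ p, (U (p - h0 • e) - U p) * (φ p.1 * U p ^ (m * r))) +
      ∫ p, (U (p - h0 • e) - U p) * d p := by
    have : H h0 = ∫ p, U (p - h0 • e) * ψ p := by
      simp only [hH]
      rw [← integral_sub_right_eq_self _ (h0 • e)]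
      congr 1; funext p
      rw [sub_add_cancel]
    have h00 : H 0 = ∫ p, U p * ψ p := by simp [hH]
    rw [this, h00, ← integral_sub k1 k2, ← integral_add k4 k3]
    congr 1; funext p
    simp only [hd]; ring
  have b6 := FTE.int_close (fun p => U (p - h0 • e) - U p) d C κ hC hdiffK hdi hdκ
  rw [abs_le] at b6
  have k5 : Integrable fun p : FTE.PS N => U (p - h0 • e) ^ (m * r + 1) * φ p.1 := by
    apply hS1i'.mul_bdd (c := Kφ) (hφm.comp measurable_fst).aestronglyMeasurable
    exact Filter.Eventually.of_forall fun p => hφb _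
  have k6 : Integrable fun p : FTE.PS N => U p ^ (m * r + 1) * φ p.1 := by
    apply hS1i.mul_bdd (c := Kφ) (hφm.comp measurable_fst).aestronglyMeasurable
    exact Filter.Eventually.of_forall fun p => hφb _
  have e2 : (∫ p : FTE.PS N, U p ^ (m * r + 1) * φ (p.1 + h0)) =
      ∫ p, U (p - h0 • e) ^ (m * r + 1) * φ p.1 := by
    rw [← integral_sub_right_eq_self _ (h0 • e)]
    congr 1; funext p
    simp [he]
  have b7 : (∫ p, (U (p - h0 • e) - U p) * (φ p.1 * U p ^ (m * r))) ≤
      1 / (m * r + 1) * ((∫ p, U p ^ (m * r + 1) * φ (p.1 + h0)) -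
          ∫ p, U p ^ (m * r + 1) * φ p.1) := by
    rw [e2, ← integral_sub k5 k6, ← integral_const_mul]
    apply integral_mono k4 ((k5.sub k6).const_mul _)
    intro p
    have h1 := FTE.convex_ineq (U p) (U (p - h0 • e)) (m * r) (h.U0 _) (h.U0 _) hmr
    have h2 := mul_le_mul_of_nonneg_right h1 (hφ0 p.1)
    simp only [Pi.sub_apply]
    rw [one_div, le_inv_mul_iff₀ (by linarith)]
    calc _ = (m * r + 1) * (U p ^ (m * r) * (U (p - h0 • e) - U p)) * φ p.1 := by ring
      _ ≤ _ := h2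
      _ = _ := by ring
  have : h0 * dlow = dlow * (h0 - 0) := by ring
  rw [this]
  linarith [b6.2]

end

lemma FTE.energy {N : ℕ} {m q B R T C : ℝ} {U : FTE.PS N → ℝ}
    {G : FTE.PS N → EuclideanSpace ℝ (Fin N)}
    (h : FTE.LocSol N m q B R T C U G) (hm : 1 ≤ m) (hq : 0 < q) (hB : 0 < B)
    (hC : 0 ≤ C) (a b : ℝ) (ha : 0 < a) (hb : b < T)
    (φ : ℝ → ℝ) (hφ : ContDiff ℝ 1 φ) (hφs : ∀ t, t ∉ Icc a b → φ t = 0) (hφ0 : ∀ t, 0 ≤ φ t)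
    (r : ℕ) (hr : 2 ≤ r) :
    B * (∫ p, φ p.1 * U p ^ (m * r + q)) ≤
      1 / (m * r + 1) * ∫ p, U p ^ (m * r + 1) * deriv φ p.1 := by
  have hφc : HasCompactSupport φ := HasCompactSupport.intro isCompact_Icc hφs
  obtain ⟨Kφ, hKφ⟩ := hφc.exists_bound_of_continuous hφ.continuous
  obtain ⟨Lφ, hLφ⟩ := (hφc.fderiv ℝ).exists_bound_of_continuous (hφ.continuous_fderiv one_ne_zero)
  have hφK : ∀ t, φ t ≤ Kφ := fun t => (le_abs_self _).trans (hKφ t)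
  have hKφ0 : 0 ≤ Kφ := (hφ0 0).trans (hφK 0)
  have hr0 : (0:ℝ) < r := by positivity
  have hmr : 0 < m * r := by positivity
  have hCm : 0 ≤ C ^ m := Real.rpow_nonneg hC _
  have hCq : 0 ≤ C ^ q := Real.rpow_nonneg hC _
  obtain ⟨hVi, hV0, hVC, hVs⟩ := FTE.intUpow h m (by linarith)
  obtain ⟨hQi, hQ0, hQC, hQs⟩ := FTE.intUpow h q hq
  obtain ⟨hS1i, hS10, hS1C, hS1s⟩ := FTE.intUpow h (m * r + 1) (by linarith)
  set e : FTE.PS N := (1, 0) with he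
  set D := ∫ p, U p ^ (m * r + 1) * deriv φ p.1 with hD
  set I := ∫ p, φ p.1 * U p ^ (m * r + q) with hI
  set K : ℝ → ℝ := fun t => ∫ p, U p ^ (m * r + 1) * φ (p.1 + t) with hK
  have hKd : HasDerivAt K D 0 := by
    have hfd : ∀ p : FTE.PS N, HasFDerivAt (fun p : FTE.PS N => φ p.1)
        ((fderiv ℝ φ p.1).comp (ContinuousLinearMap.fst ℝ ℝ (EuclideanSpace ℝ (Fin N)))) p :=
      fun p => ((hφ.differentiable one_ne_zero) p.1).hasFDerivAt.comp p hasFDerivAt_fst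
    have h1 := FTE.deriv_shift (fun p => U p ^ (m * r + 1)) (fun p : FTE.PS N => φ p.1) hS1i
      (hφ.comp contDiff_fst) Lφ Kφ
      (fun p => by
        rw [(hfd p).fderiv]
        refine (ContinuousLinearMap.opNorm_comp_le _ _).trans ?_
        calc _ ≤ Lφ * 1 := mul_le_mul (hLφ _) (ContinuousLinearMap.norm_fst_le _ _ _)
              (norm_nonneg _) ((norm_nonneg _).trans (hLφ 0))
          _ = Lφ := mul_one _) (fun p => hKφ _) e 0
    convert h1 using 1
    · funext t
      simp [hK, he]
    · rw [hD]
      congr 1; funext p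
      rw [(hfd _).fderiv]
      simp [he]
  set K1 := Kφ * (r * (C ^ m) ^ (r - 1)) with hK1
  set Kψ := Kφ * (C ^ m) ^ r with hKψ
  have hK1' : 0 ≤ K1 := by positivity
  have hKψ' : 0 ≤ Kψ := by positivity
  have key : ∀ η : ℝ, 0 < η → B * I - (2 * K1 + B * Kψ + 1) * η ≤ 1 / (m * r + 1) * D := by
    intro η hη
    obtain ⟨δ1, hδ1, hG⟩ := FTE.transl 2 (by norm_num) G h.G2 η hη
    obtain ⟨δ2, hδ2, hU⟩ := FTE.transl 1 le_rfl (fun p => U p ^ q)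
      (by simpa using memLp_one_iff_integrable.2 hQi) η hη
    obtain ⟨δ, hδ0, hδ⟩ : ∃ δ > 0, δ ≤ δ1 ∧ δ ≤ δ2 ∧ δ ≤ 1 ∧ δ < a ∧ δ < T - b := by
      refine ⟨min (min δ1 δ2) (min 1 (min (a/2) ((T-b)/2))), ?_, ?_, ?_, ?_, ?_, ?_⟩
      · have : 0 < T - b := by linarith
        positivity
      · exact (min_le_left _ _).trans (min_le_left _ _)
      · exact (min_le_left _ _).trans (min_le_right _ _)
      · exact (min_le_right _ _).trans (min_le_left _ _)
      · have := (min_le_right (min δ1 δ2) (min 1 (min (a/2) ((T-b)/2)))).trans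
          ((min_le_right _ _).trans (min_le_left _ _))
        linarith
      · have := (min_le_right (min δ1 δ2) (min 1 (min (a/2) ((T-b)/2)))).trans
          ((min_le_right _ _).trans (min_le_right _ _))
        linarith
    obtain ⟨hd1, hd2, hd3, hd4, hd5⟩ := hδ
    have hstep : ∀ t, 0 < t → t < δ → B * I - (2 * K1 + B * Kψ + 1) * η ≤
        1 / (m * r + 1) * (t⁻¹ * (K t - K 0)) := by
      intro t ht htδ
      set A := (t * (B * C ^ q) + C) * K1 with hA
      have hA0 : 0 ≤ A := by positivity
      set η' := t * η / (A + 1) with hη'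
      have hη'0 : 0 < η' := by positivity
      have hAη : A * η' ≤ t * η := by
        rw [hη', mul_div_assoc', div_le_iff₀ (by positivity)]
        have : 0 < t * η := by positivity
        nlinarith
      obtain ⟨δ3, hδ3, hV⟩ := FTE.transl 1 le_rfl (fun p => U p ^ m)
        (by simpa using memLp_one_iff_integrable.2 hVi) η' hη'0
      obtain ⟨ρ, hρ, hρc, hρ0, hρi, hρ1, hρs⟩ := FTE.exists_moll (P := FTE.PS N) (min δ δ3)
        (by positivity)
      have hVm := FTE.mol_L1 ρ (fun p => U p ^ m) hVi (C ^ m) hV0 hVC hρ.continuous hρi hρ0 hρ1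
        (min δ δ3) η' hρs hη'0.le (fun y hy => hV y (hy.trans_le (min_le_right _ _)))
      have hs := FTE.energy_step h hm hq hB hC ρ hρ hρc hρ0 hρi hρ1 δ a b
        (fun y hy => hρs y ((min_le_left _ _).trans hy)) hd3 hd4 hd5 φ hφ hφs Kφ hφ0 hφK r hr t ht
        htδ η η' hη.le hη'0.le (fun y hy => hG y (by linarith)) (fun y hy => hU y (by linarith))
        hVm K1 Kψ (K1 * η') hK1 hKψ rfl
      have e0 : K 0 = ∫ p, U p ^ (m * r + 1) * φ p.1 := by simp [hK]
      have e1 : K t = ∫ p, U p ^ (m * r + 1) * φ (p.1 + t) := rfl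
      rw [← e0, ← e1, ← hI] at hs
      have h2 : t * (B * I - (2 * K1 + B * Kψ + 1) * η) ≤ 1 / (m * r + 1) * (K t - K 0) := by
        have : A * η' = t * (B * (C ^ q * (K1 * η'))) + C * (K1 * η') := by rw [hA]; ring
        nlinarith
      calc _ = t⁻¹ * (t * (B * I - (2 * K1 + B * Kψ + 1) * η)) := by field_simp
        _ ≤ t⁻¹ * (1 / (m * r + 1) * (K t - K 0)) :=
            mul_le_mul_of_nonneg_left h2 (inv_nonneg.2 ht.le)
        _ = _ := by ring
    have hlim := (hKd.tendsto_slope_zero_right).const_mul (1 / (m * r + 1))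
    refine ge_of_tendsto hlim ?_
    filter_upwards [Ioo_mem_nhdsGT hδ0] with t ht
    have := hstep t ht.1 ht.2
    simpa using this
  set c := 2 * K1 + B * Kψ + 1 with hc
  have hc0 : 0 < c := by positivity
  apply le_of_forall_pos_le_add
  intro ε hε
  have := key (ε / c) (by positivity)
  rw [mul_div_cancel₀ _ hc0.ne'] at this
  linarith

lemma FTE.possq (x : ℝ) : HasDerivAt (fun x : ℝ => max x 0 ^ 2) (2 * max x 0) x := by
  have hne : ∀ y : ℝ, y ≠ 0 → HasDerivAt (fun x : ℝ => max x 0 ^ 2) (2 * max y 0) y := by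
    intro y hy
    rcases lt_or_gt_of_ne hy with h | h
    · rw [max_eq_right h.le, mul_zero]
      refine (hasDerivAt_const y (0:ℝ)).congr_of_eventuallyEq ?_
      filter_upwards [Iio_mem_nhds h] with z hz
      rw [max_eq_right (le_of_lt hz)]; norm_num
    · rw [max_eq_left h.le]
      have := hasDerivAt_pow 2 y
      refine HasDerivAt.congr_of_eventuallyEq (f := fun x => x ^ 2) (by simpa using this) ?_
      filter_upwards [Ioi_mem_nhds h] with z hz
      rw [max_eq_left (le_of_lt hz)]
  by_cases hx : x = 0
  · subst hx
    exact hasDerivAt_of_hasDerivAt_of_ne (g := fun x : ℝ => 2 * max x 0) hne (by fun_prop) (by fun_prop)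
  · exact hne x hx

lemma FTE.bump (a b μ : ℝ) : ∃ φ χ : ℝ → ℝ,
    (∀ t, φ t = Real.exp (μ * t) * (max (t - a) 0 ^ 2 * max (b - t) 0 ^ 2)) ∧
    (∀ t, χ t = Real.exp (μ * t) * (2 * max (t - a) 0 * max (b - t) 0 *
      (max (b - t) 0 - max (t - a) 0))) ∧
    Continuous χ ∧ ContDiff ℝ 1 φ ∧ (∀ t, deriv φ t = μ * φ t + χ t) := by
  refine ⟨fun t => Real.exp (μ * t) * (max (t - a) 0 ^ 2 * max (b - t) 0 ^ 2),
    fun t => Real.exp (μ * t) * (2 * max (t - a) 0 * max (b - t) 0 *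
      (max (b - t) 0 - max (t - a) 0)), fun t => rfl, fun t => rfl, by fun_prop, ?_⟩
  have hd : ∀ t, HasDerivAt (fun t => Real.exp (μ * t) * (max (t - a) 0 ^ 2 * max (b - t) 0 ^ 2))
      (μ * (Real.exp (μ * t) * (max (t - a) 0 ^ 2 * max (b - t) 0 ^ 2)) +
      Real.exp (μ * t) * (2 * max (t - a) 0 * max (b - t) 0 *
      (max (b - t) 0 - max (t - a) 0))) t := by
    intro t
    have h1 : HasDerivAt (fun t => max (t - a) 0 ^ 2) (2 * max (t - a) 0 * 1) t :=
      HasDerivAt.comp t (h₂ := fun x : ℝ => max x 0 ^ 2) (FTE.possq (t - a)) ((hasDerivAt_id' t).sub_const a)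
    have h2 : HasDerivAt (fun t => max (b - t) 0 ^ 2) (2 * max (b - t) 0 * (-1)) t :=
      HasDerivAt.comp t (h₂ := fun x : ℝ => max x 0 ^ 2) (FTE.possq (b - t)) ((hasDerivAt_id' t).const_sub b)
    have h3 : HasDerivAt (fun t => Real.exp (μ * t)) (Real.exp (μ * t) * (μ * 1)) t :=
      ((hasDerivAt_id t).const_mul μ).exp
    have h4 := h3.fun_mul (h1.fun_mul h2)
    exact h4.congr_deriv (by ring)
  refine ⟨contDiff_one_iff_deriv.2 ⟨fun t => (hd t).differentiableAt, ?_⟩, fun t => (hd t).deriv⟩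
  have : deriv (fun t => Real.exp (μ * t) * (max (t - a) 0 ^ 2 * max (b - t) 0 ^ 2)) = _ :=
    funext fun t => (hd t).deriv
  rw [this]
  fun_prop

lemma FTE.chi_bound (a L t : ℝ) (hL : 0 < L) :
    (t ≤ a ∨ a + 2 * L ≤ t → 2 * max (t - a) 0 * max (a + 2 * L - t) 0 *
      (max (a + 2 * L - t) 0 - max (t - a) 0) = 0) ∧
    (a ≤ t → t ≤ a + L → 2 * max (t - a) 0 * max (a + 2 * L - t) 0 *
      (max (a + 2 * L - t) 0 - max (t - a) 0) ≤ 8 * L ^ 3) ∧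
    (a + L ≤ t → 2 * max (t - a) 0 * max (a + 2 * L - t) 0 *
      (max (a + 2 * L - t) 0 - max (t - a) 0) ≤ 0) ∧
    (a + 4 * L / 3 ≤ t → t ≤ a + 5 * L / 3 → 2 * max (t - a) 0 * max (a + 2 * L - t) 0 *
      (max (a + 2 * L - t) 0 - max (t - a) 0) ≤ - (16 / 27 * L ^ 3)) := by
  refine ⟨?_, ?_, ?_, ?_⟩
  · rintro (h | h)
    · rw [max_eq_right (by linarith : t - a ≤ 0)]; ring
    · rw [max_eq_right (by linarith : a + 2 * L - t ≤ 0)]; ring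
  · intro h1 h2
    rw [max_eq_left (by linarith : 0 ≤ t - a), max_eq_left (by linarith : 0 ≤ a + 2 * L - t)]
    have hx : 0 ≤ t - a := by linarith
    have e : a + 2 * L - t = 2 * L - (t - a) := by ring
    rw [e]
    generalize t - a = x at *
    have h3 : x ≤ L := by linarith
    calc 2 * x * (2 * L - x) * (2 * L - x - x) ≤ 2 * L * (2 * L) * (2 * L) := by
          apply mul_le_mul _ (by linarith) (by linarith) (by positivity)
          apply mul_le_mul (by linarith) (by linarith) (by linarith) (by positivity)
      _ = _ := by ring
  · intro h
    rw [max_eq_left (by linarith : 0 ≤ t - a)]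
    have hy : max (a + 2 * L - t) 0 ≤ t - a := max_le (by linarith) (by linarith)
    apply mul_nonpos_of_nonneg_of_nonpos
    · exact mul_nonneg (by linarith) (le_max_right _ _)
    · linarith
  · intro h1 h2
    rw [max_eq_left (by linarith : 0 ≤ t - a), max_eq_left (by linarith : 0 ≤ a + 2 * L - t)]
    have e : a + 2 * L - t = 2 * L - (t - a) := by ring
    rw [e]
    have h3 : 4 * L / 3 ≤ t - a := by linarith
    have h4 : t - a ≤ 5 * L / 3 := by linarith
    generalize t - a = x at *
    have : 2 * (4 * L / 3) * (L / 3) * (2 * L / 3) ≤ 2 * x * (2 * L - x) * (x - (2 * L - x)) := by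
      apply mul_le_mul _ (by linarith) (by positivity)
      · apply mul_nonneg <;> linarith
      apply mul_le_mul (by linarith) (by linarith) (by positivity) (by linarith)
    nlinarith

lemma FTE.decay {N : ℕ} {m q B R T C : ℝ} {U : FTE.PS N → ℝ}
    {G : FTE.PS N → EuclideanSpace ℝ (Fin N)}
    (h : FTE.LocSol N m q B R T C U G) (hm : 1 ≤ m) (hq : 0 < q) (hq1 : q < 1) (hB : 0 < B)
    (hC : 0 ≤ C) (a L M : ℝ) (ha : 0 < a) (hL : 0 < L) (hT : a + 2 * L < T) (hM : 0 < M)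
    (hMb : ∀ᵐ p : FTE.PS N, a ≤ p.1 → U p ≤ M) :
    ∀ᵐ p : FTE.PS N, a + 4 * L / 3 ≤ p.1 → p.1 ≤ a + 5 * L / 3 →
      U p ≤ M * Real.exp (-(B * M ^ (q - 1) * (L / 3))) := by
  set l := B * M ^ (q - 1) with hl
  set M' := M * Real.exp (-(l * (L / 3))) with hM'
  have hM'0 : 0 < M' := by positivity
  have hmain : ∀ ε : ℝ, 0 < ε →
      volume {p : FTE.PS N | (a + 4 * L / 3 ≤ p.1 ∧ p.1 ≤ a + 5 * L / 3) ∧ M' * (1 + ε) < U p} = 0 := by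
    intro ε hε
    set S := {p : FTE.PS N | (a + 4 * L / 3 ≤ p.1 ∧ p.1 ≤ a + 5 * L / 3) ∧ M' * (1 + ε) < U p} with hS
    set A := Icc a (a + L) ×ˢ Metric.closedBall (0 : EuclideanSpace ℝ (Fin N)) R with hA
    have hAm : MeasurableSet A := measurableSet_Icc.prod Metric.isClosed_closedBall.measurableSet
    have hSm : MeasurableSet S := by
      apply MeasurableSet.inter
      · exact (measurableSet_le measurable_const measurable_fst).inter
          (measurableSet_le measurable_fst measurable_const)
      · exact measurableSet_lt measurable_const h.mU
    have hAf : volume A ≠ ⊤ := (isCompact_Icc.prod (isCompact_closedBall _ _)).measure_lt_top.ne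
    have hUpos : ∀ p ∈ S, ‖p.2‖ ≤ R := by
      intro p hp
      by_contra hc
      push Not at hc
      have h1 := h.supp p (Or.inr (Or.inr hc.le))
      have h2 := hp.2
      rw [h1] at h2
      have : 0 < M' * (1 + ε) := by positivity
      linarith
    have hSf : volume S ≠ ⊤ := by
      refine (lt_of_le_of_lt (measure_mono (t := Icc (a + 4 * L / 3) (a + 5 * L / 3) ×ˢ
        Metric.closedBall (0 : EuclideanSpace ℝ (Fin N)) R) ?_)
        (isCompact_Icc.prod (isCompact_closedBall _ _)).measure_lt_top).ne
      intro p hp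
      exact ⟨hp.1, by simpa using hUpos p hp⟩
    have hr : ∀ r : ℕ, 2 ≤ r → (1 + r * ε) * volume.real S ≤ 27 / 2 * volume.real A := by
      intro r hr
      have hr0 : (0:ℝ) < r := by positivity
      have hmr : 0 < m * r := by positivity
      set σ := m * r + 1 with hσ
      have hσ0 : 0 < σ := by linarith
      obtain ⟨φ, χ, hφe, hχe, hχc, hφ, hφd⟩ := FTE.bump a (a + 2 * L) (σ * l)
      have hφ0 : ∀ t, 0 ≤ φ t := fun t => by rw [hφe]; positivity
      have hφs : ∀ t, t ∉ Icc a (a + 2 * L) → φ t = 0 := fun t ht => by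
        rw [hφe]
        by_cases h1 : t ≤ a
        · rw [max_eq_right (by linarith : t - a ≤ 0)]; ring
        · have : a + 2 * L ≤ t := by
            by_contra hc
            push Not at hc h1
            exact ht ⟨h1.le, hc.le⟩
          rw [max_eq_right (by linarith : a + 2 * L - t ≤ 0)]; ring
      have hχs : ∀ t, t ∉ Icc a (a + 2 * L) → χ t = 0 := fun t ht => by
        rw [hχe, (FTE.chi_bound a L t hL).1, mul_zero]
        by_contra hc
        push Not at hc
        exact ht ⟨hc.1.le, hc.2.le⟩
      obtain ⟨Kφ, hKφ⟩ := (HasCompactSupport.intro isCompact_Icc hφs).exists_bound_of_continuous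
        hφ.continuous
      obtain ⟨Kχ, hKχ⟩ := (HasCompactSupport.intro isCompact_Icc hχs).exists_bound_of_continuous
        hχc
      have hSi := (FTE.intUpow h σ hσ0).1
      have hQi := (FTE.intUpow h (m * r + q) (by linarith)).1
      have i1 : Integrable fun p : FTE.PS N => U p ^ σ * φ p.1 :=
        hSi.mul_bdd (c := Kφ) (hφ.continuous.measurable.comp measurable_fst).aestronglyMeasurable
          (Filter.Eventually.of_forall fun p => hKφ _)
      have i2 : Integrable fun p : FTE.PS N => U p ^ σ * χ p.1 :=
        hSi.mul_bdd (c := Kχ) (hχc.measurable.comp measurable_fst).aestronglyMeasurable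
          (Filter.Eventually.of_forall fun p => hKχ _)
      have i3 : Integrable fun p : FTE.PS N => φ p.1 * U p ^ (m * r + q) :=
        hQi.bdd_mul (c := Kφ) (hφ.continuous.measurable.comp measurable_fst).aestronglyMeasurable
          (Filter.Eventually.of_forall fun p => hKφ _)
      have hen := FTE.energy h hm hq hB hC a (a + 2 * L) ha hT φ hφ hφs hφ0 r hr
      rw [← hσ] at hen
      have e1 : ∫ p : FTE.PS N, U p ^ σ * deriv φ p.1 =
          σ * l * (∫ p : FTE.PS N, U p ^ σ * φ p.1) + ∫ p : FTE.PS N, U p ^ σ * χ p.1 := by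
        rw [← integral_const_mul, ← integral_add (i1.const_mul _) i2]
        congr 1; funext p
        rw [hφd]; ring
      have e2 : l * (∫ p : FTE.PS N, U p ^ σ * φ p.1) ≤
          B * ∫ p : FTE.PS N, φ p.1 * U p ^ (m * r + q) := by
        rw [← integral_const_mul, ← integral_const_mul]
        apply integral_mono_ae (i1.const_mul _) (i3.const_mul _)
        filter_upwards [hMb] with p hp
        by_cases hpa : p.1 ∈ Icc a (a + 2 * L)
        · have hUM := hp hpa.1
          have h3 : M ^ (q - 1) * U p ^ σ ≤ U p ^ (m * r + q) := by
            rcases (h.U0 p).eq_or_lt with h0 | h0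
            · rw [← h0, Real.zero_rpow hσ0.ne', Real.zero_rpow (by linarith)]; simp
            · have : m * r + q = (q - 1) + σ := by rw [hσ]; ring
              rw [this, Real.rpow_add h0 (q - 1) σ]
              apply mul_le_mul_of_nonneg_right _ (Real.rpow_nonneg h0.le _)
              exact Real.rpow_le_rpow_of_nonpos h0 hUM (by linarith)
          have h4 := mul_le_mul_of_nonneg_left h3 (mul_nonneg hB.le (hφ0 p.1))
          calc l * (U p ^ σ * φ p.1) = B * φ p.1 * (M ^ (q - 1) * U p ^ σ) := by rw [hl]; ring
            _ ≤ _ := h4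
            _ = _ := by ring
        · rw [hφs _ hpa]; simp
      have e3 : 0 ≤ ∫ p : FTE.PS N, U p ^ σ * χ p.1 := by
        rw [e1] at hen
        have h5 := e2.trans hen
        rw [one_div, le_inv_mul_iff₀ hσ0] at h5
        linarith
      set c1 := Real.exp (σ * l * (a + L)) * M ^ σ * L ^ 3 with hc1
      have hc10 : 0 < c1 := by positivity
      have e4 : ∫ p : FTE.PS N, U p ^ σ * χ p.1 ≤ ∫ p : FTE.PS N, (A.indicator (fun _ => 8 * c1) p
          - S.indicator (fun _ => 16 / 27 * c1 * (1 + ε) ^ σ) p) := by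
        apply integral_mono_ae i2
        · exact ((integrable_indicator_iff hAm).2 (integrableOn_const hAf)).sub
            ((integrable_indicator_iff hSm).2 (integrableOn_const hSf))
        filter_upwards [hMb] with p hp
        obtain ⟨b1, b2, b3, b4⟩ := FTE.chi_bound a L p.1 hL
        have hUσ : 0 ≤ U p ^ σ := Real.rpow_nonneg (h.U0 p) _
        by_cases hpS : p ∈ S
        · have hpA : p ∉ A := fun hc => by
            have := hpS.1.1; have := hc.1.2; linarith
          rw [indicator_of_mem hpS, indicator_of_notMem hpA, zero_sub, hχe]
          have b5 := b4 hpS.1.1 hpS.1.2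
          have g1 : (M' * (1 + ε)) ^ σ ≤ U p ^ σ :=
            Real.rpow_le_rpow (by positivity) hpS.2.le hσ0.le
          have g2 : Real.exp (σ * l * (a + 4 * L / 3)) ≤ Real.exp (σ * l * p.1) := by
            apply Real.exp_le_exp.2
            exact mul_le_mul_of_nonneg_left hpS.1.1 (by positivity)
          have g3 : Real.exp (σ * l * (a + 4 * L / 3)) * (M' * (1 + ε)) ^ σ =
              Real.exp (σ * l * (a + L)) * M ^ σ * (1 + ε) ^ σ := by
            rw [Real.mul_rpow hM'0.le (by linarith), hM', Real.mul_rpow hM.le (Real.exp_nonneg _),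
              ← Real.exp_mul]
            have : Real.exp (σ * l * (a + L)) = Real.exp (σ * l * (a + 4 * L / 3)) *
                Real.exp (-(l * (L / 3)) * σ) := by
              rw [← Real.exp_add]; congr 1; ring
            rw [this]; ring
          have g4 := mul_le_mul g2 g1 (by positivity) (Real.exp_nonneg _)
          rw [g3] at g4
          have g5 := mul_le_mul g4 (neg_le_neg b5) (by rw [neg_neg]; positivity) (by positivity)
          calc _ = -(Real.exp (σ * l * p.1) * U p ^ σ * -(2 * max (p.1 - a) 0 * max (a + 2 * L - p.1) 0 *
                  (max (a + 2 * L - p.1) 0 - max (p.1 - a) 0))) := by ring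
            _ ≤ _ := neg_le_neg g5
            _ = _ := by rw [hc1]; ring
        · rw [indicator_of_notMem hpS, sub_zero]
          by_cases hpA : p ∈ A
          · rw [indicator_of_mem hpA, hχe]
            have b5 := b2 hpA.1.1 hpA.1.2
            have g1 : U p ^ σ ≤ M ^ σ := Real.rpow_le_rpow (h.U0 p) (hp hpA.1.1) hσ0.le
            have g2 : Real.exp (σ * l * p.1) ≤ Real.exp (σ * l * (a + L)) := by
              apply Real.exp_le_exp.2
              exact mul_le_mul_of_nonneg_left hpA.1.2 (by positivity)
            have g4 := mul_le_mul g2 g1 hUσ (Real.exp_nonneg _)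
            calc _ = (Real.exp (σ * l * p.1) * U p ^ σ) * (2 * max (p.1 - a) 0 * max (a + 2 * L - p.1) 0 *
                  (max (a + 2 * L - p.1) 0 - max (p.1 - a) 0)) := by ring
              _ ≤ (Real.exp (σ * l * p.1) * U p ^ σ) * (8 * L ^ 3) :=
                  mul_le_mul_of_nonneg_left b5 (by positivity)
              _ ≤ (Real.exp (σ * l * (a + L)) * M ^ σ) * (8 * L ^ 3) :=
                  mul_le_mul_of_nonneg_right g4 (by positivity)
              _ = _ := by rw [hc1]; ring
          · rw [indicator_of_notMem hpA]
            by_cases hR : R ≤ ‖p.2‖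
            · rw [h.supp p (Or.inr (Or.inr hR)), Real.zero_rpow hσ0.ne', zero_mul]
            · apply mul_nonpos_of_nonneg_of_nonpos hUσ
              rw [hχe]
              apply mul_nonpos_of_nonneg_of_nonpos (Real.exp_nonneg _)
              by_cases hta : p.1 ≤ a
              · rw [b1 (Or.inl hta)]
              · apply b3
                by_contra hc
                push Not at hR hta hc
                exact hpA ⟨⟨hta.le, hc.le⟩, by simpa using hR.le⟩
      rw [integral_sub ((integrable_indicator_iff hAm).2 (integrableOn_const hAf))
            ((integrable_indicator_iff hSm).2 (integrableOn_const hSf)),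
            integral_indicator_const _ hAm, integral_indicator_const _ hSm, smul_eq_mul,
            smul_eq_mul] at e4
      have e5 : (1 + ε) ^ σ * volume.real S ≤ 27 / 2 * volume.real A := by
        have := e3.trans e4
        have h6 : c1 * ((1 + ε) ^ σ * volume.real S) ≤ c1 * (27 / 2 * volume.real A) := by nlinarith
        exact le_of_mul_le_mul_left h6 hc10
      have e6 : 1 + r * ε ≤ (1 + ε) ^ σ := by
        have h7 := one_add_mul_le_pow (by linarith : -2 ≤ ε) r
        rw [← Real.rpow_natCast] at h7
        refine h7.trans (Real.rpow_le_rpow_of_exponent_le (by linarith) ?_)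
        rw [hσ]; nlinarith
      exact (mul_le_mul_of_nonneg_right e6 measureReal_nonneg).trans e5
    by_contra hne
    have hpos : 0 < volume.real S := ENNReal.toReal_pos hne hSf
    obtain ⟨n, hn⟩ := exists_nat_gt (27 / 2 * volume.real A / (ε * volume.real S))
    rw [div_lt_iff₀ (by positivity)] at hn
    have := hr (n + 2) (by omega)
    push_cast at this
    nlinarith [mul_pos hε hpos]
  have hall : ∀ n : ℕ, ∀ᵐ p : FTE.PS N, ¬ ((a + 4 * L / 3 ≤ p.1 ∧ p.1 ≤ a + 5 * L / 3) ∧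
      M' * (1 + 1 / ((n:ℝ) + 1)) < U p) := by
    intro n
    rw [ae_iff]
    simp only [not_not]
    exact hmain _ (by positivity)
  filter_upwards [ae_all_iff.2 hall] with p hp h1 h2
  have hlim : Filter.Tendsto (fun n : ℕ => M' * (1 + 1 / ((n:ℝ) + 1))) Filter.atTop
      (nhds (M' * (1 + 0))) := (tendsto_one_div_add_atTop_nhds_zero_nat.const_add 1).const_mul M'
  rw [add_zero, mul_one] at hlim
  refine ge_of_tendsto' hlim fun n => ?_
  by_contra hc
  push Not at hc
  exact hp n ⟨⟨h1, h2⟩, hc⟩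

lemma FTE.iter {N : ℕ} (T : ℝ) (F f : FTE.PS N → ℝ) (hF : Integrable F)
    (h0 : ∀ p : FTE.PS N, p.1 ∉ Ioo 0 T → F p = 0)
    (hff : ∀ᵐ p : FTE.PS N, p.1 ∈ Ioo 0 T → F p = f p) :
    ∫ p, F p = ∫ s in Ioo 0 T, ∫ x, f (s, x) := by
  have e1 : ∫ p, F p = ∫ s, ∫ x, F (s, x) := integral_prod F hF
  rw [e1, ← setIntegral_eq_integral_of_forall_compl_eq_zero (s := Ioo 0 T)]
  · apply setIntegral_congr_ae measurableSet_Ioo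
    have h1 := Measure.ae_ae_of_ae_prod hff
    filter_upwards [h1] with s hs hsT
    apply integral_congr_ae
    filter_upwards [hs] with x hx
    exact hx hsT
  · intro s hs
    simp [h0 (s, _) hs]

lemma FTE.int_dt {N : ℕ} (u0 : EuclideanSpace ℝ (Fin N) → ℝ) (ζ : FTE.PS N → ℝ)
    (hζ : ContDiff ℝ 1 ζ) (hζc : HasCompactSupport ζ)
    (hi : Integrable fun p : FTE.PS N => u0 p.2 * fderiv ℝ ζ p (1, 0)) :
    ∫ p : FTE.PS N, u0 p.2 * fderiv ℝ ζ p (1, 0) = 0 := by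
  have e1 : ∫ p : FTE.PS N, u0 p.2 * fderiv ℝ ζ p (1, 0) =
    ∫ x, ∫ t, u0 x * fderiv ℝ ζ (t, x) (1, 0) := integral_prod_symm _ hi
  rw [e1]
  rw [integral_eq_zero_of_ae]
  refine Filter.Eventually.of_forall fun x => ?_
  simp only [Pi.zero_apply]
  rw [integral_const_mul]
  have hd : ∀ t, HasDerivAt (fun t => ζ (t, x)) (fderiv ℝ ζ (t, x) (1, 0)) t := by
    intro t
    have h1 : HasFDerivAt ζ (fderiv ℝ ζ (t, x)) (t, x) :=
      ((hζ.differentiable one_ne_zero) (t, x)).hasFDerivAt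
    have h2 : HasDerivAt (fun t : ℝ => (t, x)) ((1:ℝ), (0 : EuclideanSpace ℝ (Fin N))) t :=
      (hasDerivAt_id' t).prodMk (hasDerivAt_const t x)
    exact h1.comp_hasDerivAt t h2
  have hK : IsCompact (Prod.fst '' tsupport ζ) := hζc.isCompact.image continuous_fst
  have hc1 : HasCompactSupport fun t => ζ (t, x) :=
    HasCompactSupport.intro hK fun t ht => by
      by_contra hc
      exact ht ⟨(t, x), subset_tsupport _ hc, rfl⟩
  have hc2 : HasCompactSupport fun t => fderiv ℝ ζ (t, x) (1, 0) :=
    HasCompactSupport.intro hK fun t ht => by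
      by_contra hc
      refine ht ⟨(t, x), support_fderiv_subset ℝ (fun h0 => hc ?_), rfl⟩
      rw [h0]; rfl
  have c1 : Continuous fun t : ℝ => ζ (t, x) := hζ.continuous.comp (by fun_prop)
  have c2 : Continuous fun t : ℝ => fderiv ℝ ζ (t, x) (1, 0) :=
    ((hζ.continuous_fderiv one_ne_zero).comp (by fun_prop)).clm_apply continuous_const
  rw [integral_eq_zero_of_hasDerivAt_of_integrable hd (c2.integrable_of_hasCompactSupport hc2)
    (c1.integrable_of_hasCompactSupport hc1), mul_zero]

set_option maxHeartbeats 1000000 in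
lemma FTE.loc {N : ℕ} {m q B R T C : ℝ} (hm : 1 ≤ m) (hq0 : 0 < q)
    (u0 : EuclideanSpace ℝ (Fin N) → ℝ) (hu0 : IsBddNonneg N u0)
    (u : ℝ → EuclideanSpace ℝ (Fin N) → ℝ)
    (g : ℝ → EuclideanSpace ℝ (Fin N) → EuclideanSpace ℝ (Fin N))
    (hum : Measurable (Function.uncurry u)) (hun : ∀ t x, 0 ≤ u t x) (huC : ∀ t x, u t x ≤ C)
    (hC : 0 ≤ C)
    (hgm : Measurable (Function.uncurry g))
    (hg2 : ∀ K : Set (EuclideanSpace ℝ (Fin N)), IsCompact K →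
        ∫⁻ s in Ioo (0:ℝ) T, ∫⁻ x in K, ENNReal.ofReal (‖g s x‖ ^ 2) < ⊤)
    (hw1 : ∀ ζ : ℝ × EuclideanSpace ℝ (Fin N) → ℝ, ContDiff ℝ 1 ζ →
        HasCompactSupport ζ → (∀ s x, s ∉ Ioo (0:ℝ) T → ζ (s, x) = 0) →
        ∀ i : Fin N,
          (∫ s in Ioo (0:ℝ) T, ∫ x,
              (u s x) ^ m * fderiv ℝ ζ (s, x) (0, EuclideanSpace.single i 1))
            = - ∫ s in Ioo (0:ℝ) T, ∫ x, g s x i * ζ (s, x))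
    (hw2 : ∀ ζ : ℝ × EuclideanSpace ℝ (Fin N) → ℝ, ContDiff ℝ 1 ζ →
        HasCompactSupport ζ → (∀ s x, T ≤ s → ζ (s, x) = 0) →
        ∫ s in Ioo (0:ℝ) T, ∫ x,
            ((u0 x - u s x) * fderiv ℝ ζ (s, x) (1, 0)
              + fderiv ℝ ζ (s, x) (0, g s x)
              + B * (u s x) ^ q * ζ (s, x)) = 0)
    (hae : ∀ᵐ p : FTE.PS N, 0 < p.1 → R ≤ ‖p.2‖ → u p.1 p.2 = 0) :
    FTE.LocSol N m q B R T C ((Ioo 0 T ×ˢ Metric.ball 0 R).indicator (Function.uncurry u))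
      ((Ioo 0 T ×ˢ Metric.closedBall 0 (R + 2)).indicator (Function.uncurry g)) := by
  set U := (Ioo 0 T ×ˢ Metric.ball (0 : EuclideanSpace ℝ (Fin N)) R).indicator
    (Function.uncurry u) with hU
  set S := Ioo 0 T ×ˢ Metric.closedBall (0 : EuclideanSpace ℝ (Fin N)) (R + 2) with hS
  set G := S.indicator (Function.uncurry g) with hG
  have hSm : MeasurableSet S := measurableSet_Ioo.prod Metric.isClosed_closedBall.measurableSet
  have hSf : volume S ≠ ⊤ := by
    refine (lt_of_le_of_lt (measure_mono (t := Icc 0 T ×ˢ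
      Metric.closedBall (0 : EuclideanSpace ℝ (Fin N)) (R + 2)) ?_)
      (isCompact_Icc.prod (isCompact_closedBall _ _)).measure_lt_top).ne
    exact prod_mono Ioo_subset_Icc_self subset_rfl
  have mU : Measurable U := hum.indicator (measurableSet_Ioo.prod Metric.isOpen_ball.measurableSet)
  have U0 : ∀ p, 0 ≤ U p := fun p => indicator_nonneg (fun x _ => hun _ _) p
  have UC : ∀ p, U p ≤ C := fun p => indicator_apply_le' (fun _ => huC _ _) (fun _ => hC)
  have supp : ∀ p : FTE.PS N, (p.1 ≤ 0 ∨ T ≤ p.1 ∨ R ≤ ‖p.2‖) → U p = 0 := by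
    intro p hp
    apply indicator_of_notMem
    rintro ⟨h1, h2⟩
    rw [mem_ball_zero_iff] at h2
    rcases hp with h | h | h
    · linarith [h1.1]
    · linarith [h1.2]
    · linarith
  have hUu : ∀ᵐ p : FTE.PS N, p.1 ∈ Ioo 0 T → U p = u p.1 p.2 := by
    filter_upwards [hae] with p hp hpT
    by_cases h : ‖p.2‖ < R
    · rw [hU, indicator_of_mem (by exact ⟨hpT, by simpa using h⟩)]; rfl
    · rw [supp p (Or.inr (Or.inr (not_lt.1 h))), hp hpT.1 (not_lt.1 h)]
  have hGr : MemLp (Function.uncurry g) 2 (volume.restrict S) := by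
    rw [memLp_two_iff_integrable_sq_norm hgm.aestronglyMeasurable]
    refine ⟨(hgm.norm.pow_const 2).aestronglyMeasurable, ?_⟩
    have h1 := hg2 _ (isCompact_closedBall 0 (R + 2))
    refine lt_of_eq_of_lt ?_ h1
    rw [hS, Measure.volume_eq_prod, ← Measure.prod_restrict, lintegral_prod]
    · apply lintegral_congr; intro s
      apply lintegral_congr; intro x
      rw [← ofReal_norm, Real.norm_of_nonneg (by positivity)]; rfl
    · exact (hgm.norm.pow_const 2).enorm.aemeasurable
  have hfinS : IsFiniteMeasure (volume.restrict S) := ⟨by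
    rw [Measure.restrict_apply_univ]; exact hSf.lt_top⟩
  have G2 : MemLp G 2 volume := (memLp_indicator_iff_restrict hSm).2 hGr
  have G1 : Integrable G := by
    rw [hG, integrable_indicator_iff hSm]
    exact hGr.integrable (by norm_num)
  have hUi : ∀ k : ℝ, 0 < k → Integrable fun p => U p ^ k := by
    intro k hk
    have hfin : volume (Icc (0:ℝ) T ×ˢ Metric.closedBall (0 : EuclideanSpace ℝ (Fin N)) R) < ⊤ :=
      (isCompact_Icc.prod (isCompact_closedBall _ _)).measure_lt_top
    have h1 : IntegrableOn (fun p => U p ^ k)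
        (Icc (0:ℝ) T ×ˢ Metric.closedBall (0 : EuclideanSpace ℝ (Fin N)) R) :=
      Measure.integrableOn_of_bounded hfin.ne (mU.pow_const k).aestronglyMeasurable
        (M := C ^ k) (Filter.Eventually.of_forall fun p => by
          rw [Real.norm_of_nonneg (Real.rpow_nonneg (U0 p) _)]
          exact Real.rpow_le_rpow (U0 p) (UC p) hk.le)
    refine h1.integrable_of_forall_notMem_eq_zero fun p hp => ?_
    rw [supp, Real.zero_rpow hk.ne']
    by_contra hc
    push Not at hc
    exact hp ⟨⟨hc.1.le, hc.2.1.le⟩, by simpa using hc.2.2.le⟩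
  have hUi1 : Integrable U := by simpa using hUi 1 one_pos
  have hcs : ∀ ζ : FTE.PS N → ℝ, tsupport ζ ⊆ Ioo 0 T ×ˢ Metric.ball 0 (R + 2) →
      HasCompactSupport ζ := fun ζ hζ => by
    apply HasCompactSupport.intro (K := Icc 0 T ×ˢ Metric.closedBall 0 (R + 2))
      (isCompact_Icc.prod (isCompact_closedBall _ _))
    intro p hp
    by_contra hc
    have := hζ (subset_tsupport _ hc)
    exact hp ⟨Ioo_subset_Icc_self this.1, Metric.ball_subset_closedBall this.2⟩
  have hz0 : ∀ ζ : FTE.PS N → ℝ, tsupport ζ ⊆ Ioo 0 T ×ˢ Metric.ball 0 (R + 2) →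
      ∀ p : FTE.PS N, p ∉ S → ζ p = 0 ∧ fderiv ℝ ζ p = 0 := fun ζ hζ p hp => by
    have hpt : p ∉ tsupport ζ := fun hc => hp ⟨(hζ hc).1, Metric.ball_subset_closedBall (hζ hc).2⟩
    refine ⟨image_eq_zero_of_notMem_tsupport hpt, ?_⟩
    by_contra hc
    exact hpt (support_fderiv_subset ℝ hc)
  have hST : ∀ p : FTE.PS N, p.1 ∉ Ioo 0 T → p ∉ S := fun p hp hc => hp hc.1
  have hGg : ∀ p ∈ S, G p = g p.1 p.2 := fun p hp => by
    rw [hG, indicator_of_mem hp]; rfl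
  refine ⟨mU, U0, UC, supp, G2, G1, ?_, ?_⟩
  · intro ζ hζ hζs i
    have hζc := hcs ζ hζs
    obtain ⟨Kζ, hKζ⟩ := hζc.exists_bound_of_continuous hζ.continuous
    obtain ⟨L, hL⟩ := (hζc.fderiv ℝ).exists_bound_of_continuous (hζ.continuous_fderiv one_ne_zero)
    have hcd : Continuous fun p => fderiv ℝ ζ p (0, EuclideanSpace.single i 1) :=
      (hζ.continuous_fderiv one_ne_zero).clm_apply continuous_const
    have hw := hw1 ζ hζ hζc (fun s x hs => (hz0 ζ hζs (s, x) (hST _ hs)).1) i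
    rw [FTE.iter T (fun p => U p ^ m * fderiv ℝ ζ p (0, EuclideanSpace.single i 1))
      (fun p => u p.1 p.2 ^ m * fderiv ℝ ζ p (0, EuclideanSpace.single i 1)),
      FTE.iter T (fun p => G p i * ζ p) (fun p => g p.1 p.2 i * ζ p)]
    · exact hw
    · have hGi : Integrable fun p => G p i := 
        (EuclideanSpace.proj i : EuclideanSpace ℝ (Fin N) →L[ℝ] ℝ).integrable_comp G1
      exact hGi.mul_bdd (c := Kζ) hζ.continuous.aestronglyMeasurable
        (Filter.Eventually.of_forall hKζ)
    · intro p hp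
      rw [(hz0 ζ hζs p (hST p hp)).1, mul_zero]
    · refine Filter.Eventually.of_forall fun p _ => ?_
      by_cases hp : p ∈ S
      · rw [hGg p hp]
      · simp only [(hz0 ζ hζs p hp).1, mul_zero]
    · exact (hUi m (by linarith)).mul_bdd (c := L * ‖((0:ℝ), EuclideanSpace.single i (1:ℝ))‖)
        hcd.aestronglyMeasurable (Filter.Eventually.of_forall fun p =>
          (ContinuousLinearMap.le_opNorm _ _).trans
            (mul_le_mul_of_nonneg_right (hL _) (norm_nonneg _)))
    · intro p hp
      rw [(hz0 ζ hζs p (hST p hp)).2]; simp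
    · filter_upwards [hUu] with p hp hpT
      rw [hp hpT]
  · intro ζ hζ hζs
    have hζc := hcs ζ hζs
    obtain ⟨Kζ, hKζ⟩ := hζc.exists_bound_of_continuous hζ.continuous
    obtain ⟨L, hL⟩ := (hζc.fderiv ℝ).exists_bound_of_continuous (hζ.continuous_fderiv one_ne_zero)
    have hfc := hζ.continuous_fderiv one_ne_zero
    have hcd : Continuous fun p => fderiv ℝ ζ p (1, 0) := hfc.clm_apply continuous_const
    have hw := hw2 ζ hζ hζc (fun s x hs => (hz0 ζ hζs (s, x) (hST _ (fun hc => by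
      have := hc.2; simp only at this; linarith))).1)
    have i1 : Integrable fun p => U p * fderiv ℝ ζ p (1, 0) :=
      hUi1.mul_bdd (c := L * ‖((1:ℝ), (0 : EuclideanSpace ℝ (Fin N)))‖)
        hcd.aestronglyMeasurable (Filter.Eventually.of_forall fun p =>
          (ContinuousLinearMap.le_opNorm _ _).trans
            (mul_le_mul_of_nonneg_right (hL _) (norm_nonneg _)))
    have i2 : Integrable fun p => fderiv ℝ ζ p (0, G p) := by
      refine (G1.norm.const_mul L).mono ?_ ?_
      · have hG' : AEStronglyMeasurable (fun p => ((0:ℝ), G p)) volume :=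
          (aestronglyMeasurable_const.prodMk G1.1)
        exact (ContinuousLinearMap.id ℝ (FTE.PS N →L[ℝ] ℝ)).aestronglyMeasurable_comp₂
          hfc.aestronglyMeasurable hG'
      · refine Filter.Eventually.of_forall fun p => ?_
        refine (ContinuousLinearMap.le_opNorm _ _).trans ?_
        refine le_trans ?_ (le_abs_self _)
        rw [Prod.norm_mk, norm_zero, max_eq_right (norm_nonneg _)]
        exact mul_le_mul_of_nonneg_right (hL _) (norm_nonneg _)
    have i3 : Integrable fun p => B * U p ^ q * ζ p :=
      ((hUi q hq0).const_mul B).mul_bdd (c := Kζ) hζ.continuous.aestronglyMeasurable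
        (Filter.Eventually.of_forall hKζ)
    obtain ⟨hu0m, hu00, C0, hu0C⟩ := hu0
    have hc2 : HasCompactSupport fun p => fderiv ℝ ζ p (1, 0) :=
      (hζc.fderiv ℝ).comp_left (g := fun l : FTE.PS N →L[ℝ] ℝ => l (1, 0)) rfl
    have i4 : Integrable fun p : FTE.PS N => u0 p.2 * fderiv ℝ ζ p (1, 0) :=
      (hcd.integrable_of_hasCompactSupport hc2).bdd_mul (c := C0)
        (hu0m.comp measurable_snd).aestronglyMeasurable
        (Filter.Eventually.of_forall fun p => by
          exact (Real.norm_of_nonneg (hu00 p.2)).trans_le (hu0C p.2))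
    have hneg : Integrable fun p => -(U p * fderiv ℝ ζ p (1, 0)) := i1.neg
    have i12 : Integrable fun p => -(U p * fderiv ℝ ζ p (1, 0)) + fderiv ℝ ζ p (0, G p) :=
      hneg.add i2
    have i5 : Integrable fun p => -(U p * fderiv ℝ ζ p (1, 0)) + fderiv ℝ ζ p (0, G p) +
      B * U p ^ q * ζ p := i12.add i3
    have e1 := FTE.int_dt u0 ζ hζ hζc i4
    have e2 := integral_add i5 i4
    rw [e1, add_zero] at e2
    rw [← e2]
    have i6 : Integrable fun p : FTE.PS N => -(U p * fderiv ℝ ζ p (1, 0)) + fderiv ℝ ζ p (0, G p) +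
      B * U p ^ q * ζ p + u0 p.2 * fderiv ℝ ζ p (1, 0) := i5.add i4
    rw [FTE.iter T _ (fun p => (u0 p.2 - u p.1 p.2) * fderiv ℝ ζ p (1, 0)
              + fderiv ℝ ζ p (0, g p.1 p.2)
              + B * (u p.1 p.2) ^ q * ζ p) i6]
    · exact hw
    · intro p hp
      obtain ⟨z1, z2⟩ := hz0 ζ hζs p (hST p hp)
      simp [z1, z2]
    · filter_upwards [hUu] with p hp hpT
      rw [hp hpT]
      by_cases hpS : p ∈ S
      · rw [hGg p hpS]; ring
      · obtain ⟨z1, z2⟩ := hz0 ζ hζs p hpS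
        simp [z1, z2]
/-- **Finite time extinction for the spatially homogeneous equation.**
Let `N ≥ 1`, `m ≥ 1`, `q ∈ (0,1)` and `B > 0`. Let `u₀ ∈ L^∞(ℝᴺ)` be non-negative and
let `u` be a non-negative weak solution of `∂ₜ u = Δ(uᵐ) − B u^q` with `u(0) = u₀`,
whose support is localized in some ball. Then `u` vanishes in finite time. -/
theorem finite_time_extinction_homogeneous
    (N : ℕ) (hN : 1 ≤ N) (m q B : ℝ) (hm : 1 ≤ m) (hq0 : 0 < q) (hq1 : q < 1)
    (hB : 0 < B)
    (u0 : EuclideanSpace ℝ (Fin N) → ℝ) (hu0 : IsBddNonneg N u0)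
    (u : ℝ → EuclideanSpace ℝ (Fin N) → ℝ)
    (hu : IsWeakSolution N m q (fun _ => B) u0 u)
    (hloc : ∃ R : ℝ, 0 < R ∧ SupportLocalized N R u) :
    VanishesInFiniteTime N u := by
  obtain ⟨hum, hun, ⟨C', hC'⟩, g, hgm, hg⟩ := hu
  obtain ⟨R, hR, hloc⟩ := hloc
  obtain ⟨C, hC1, hC⟩ : ∃ C : ℝ, 1 ≤ C ∧ ∀ t x, u t x ≤ C :=
    ⟨max C' 1, le_max_right _ _, fun t x => (hC' t x).trans (le_max_left _ _)⟩
  have hC0 : 0 < C := by linarith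
  have hae : ∀ᵐ p : FTE.PS N, 0 < p.1 → R ≤ ‖p.2‖ → u p.1 p.2 = 0 := by
    have hms : MeasurableSet {p : FTE.PS N | 0 < p.1 → R ≤ ‖p.2‖ → u p.1 p.2 = 0} := by
      have : {p : FTE.PS N | 0 < p.1 → R ≤ ‖p.2‖ → u p.1 p.2 = 0} =
          ({p : FTE.PS N | 0 < p.1} ∩ {p : FTE.PS N | R ≤ ‖p.2‖} ∩
            {p : FTE.PS N | Function.uncurry u p = 0}ᶜ)ᶜ := by
        ext p
        simp only [mem_setOf_eq, mem_compl_iff, mem_inter_iff, Function.uncurry]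
        tauto
      rw [this]
      exact (((measurableSet_lt measurable_const measurable_fst).inter
        (measurableSet_le measurable_const measurable_snd.norm)).inter
        (measurableSet_eq_fun hum measurable_const).compl).compl
    refine (Measure.ae_prod_iff_ae_ae hms).2 ?_
    filter_upwards [hloc] with t ht
    by_cases h0 : 0 < t
    · filter_upwards [ht h0] with x hx _ hxR
      exact hx hxR
    · exact Filter.Eventually.of_forall fun x hx => absurd hx h0
  have hstep : ∀ M t0 : ℝ, 0 < M → 0 < t0 → (∀ᵐ p : FTE.PS N, t0 ≤ p.1 → u p.1 p.2 ≤ M) →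
      ∀ᵐ p : FTE.PS N, t0 + 6 * Real.log 2 / B * M ^ (1 - q) ≤ p.1 → u p.1 p.2 ≤ M / 2 := by
    intro M t0 hM ht0 hP
    have hlog : 0 < Real.log 2 := Real.log_pos (by norm_num)
    set L := 3 * Real.log 2 / B * M ^ (1 - q) with hL
    have hL0 : 0 < L := by positivity
    have hexp : M * Real.exp (-(B * M ^ (q - 1) * (L / 3))) = M / 2 := by
      have h1 : B * M ^ (q - 1) * (L / 3) = Real.log 2 := by
        have h2 : M ^ (q - 1) * M ^ (1 - q) = 1 := by
          rw [← Real.rpow_add hM]; simp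
        calc _ = (B / B) * Real.log 2 * (M ^ (q - 1) * M ^ (1 - q)) := by rw [hL]; ring
          _ = _ := by rw [h2, div_self hB.ne']; ring
      rw [h1, Real.exp_neg, Real.exp_log (by norm_num)]; ring
    have hn : ∀ n : ℕ, ∀ᵐ p : FTE.PS N, t0 + n * (L / 3) + 4 * L / 3 ≤ p.1 →
        p.1 ≤ t0 + n * (L / 3) + 5 * L / 3 → u p.1 p.2 ≤ M / 2 := by
      intro n
      set a := t0 + n * (L / 3) with ha
      have hat : t0 ≤ a := by rw [ha]; linarith [(by positivity : 0 ≤ n * (L / 3))]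
      set T := a + 2 * L + 1 with hT
      have hT0 : 0 < T := by linarith
      obtain ⟨g2, w1, w2⟩ := hg T hT0
      have hls := FTE.loc (m := m) (q := q) (B := B) (R := R) (T := T) (C := C) hm hq0 u0 hu0 u g
        hum hun hC hC0.le hgm g2 w1 w2 hae
      have hd := FTE.decay hls hm hq0 hq1 hB hC0.le a L M (by linarith) hL0 (by linarith) hM (by
        filter_upwards [hP] with p hp hpa
        exact (indicator_le_self' (fun _ _ => hun _ _) p).trans (hp (hat.trans hpa)))
      rw [hexp] at hd
      filter_upwards [hd, hae] with p hp hpz h1 h2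
      by_cases hpR : ‖p.2‖ < R
      · have h3 := hp h1 h2
        rw [indicator_of_mem (by
          exact ⟨⟨by linarith, by linarith⟩, by simpa using hpR⟩)] at h3
        exact h3
      · rw [hpz (by linarith) (not_lt.1 hpR)]; positivity
    filter_upwards [ae_all_iff.2 hn] with p hp hpt
    have hx0 : 0 ≤ (p.1 - t0 - 4 * L / 3) / (L / 3) := by
      apply div_nonneg _ (by positivity)
      have : 6 * Real.log 2 / B * M ^ (1 - q) = 2 * L := by rw [hL]; ring
      rw [this] at hpt
      linarith
    have f1 := Nat.floor_le hx0
    have f2 := Nat.lt_floor_add_one ((p.1 - t0 - 4 * L / 3) / (L / 3))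
    rw [le_div_iff₀ (by positivity)] at f1
    rw [div_lt_iff₀ (by positivity)] at f2
    exact hp ⌊(p.1 - t0 - 4 * L / 3) / (L / 3)⌋₊ (by linarith) (by linarith)
  have hlog : 0 < Real.log 2 := Real.log_pos (by norm_num)
  set θ : ℝ := (1 / 2 : ℝ) ^ (1 - q) with hθ
  have hθ0 : 0 < θ := by positivity
  have hθ1 : θ < 1 := Real.rpow_lt_one (by norm_num) (by norm_num) (by linarith)
  have h1θ : 0 < 1 - θ := by linarith
  set D := 6 * Real.log 2 / B * C ^ (1 - q) / (1 - θ) with hD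
  have hD0 : 0 < D := by positivity
  have hit : ∀ n : ℕ, ∀ᵐ p : FTE.PS N, 1 + D * (1 - θ ^ n) ≤ p.1 →
      u p.1 p.2 ≤ C * (1 / 2) ^ n := by
    intro n
    induction n with
    | zero => exact Filter.Eventually.of_forall fun p _ => by simpa using hC p.1 p.2
    | succ n ih =>
      have hθn : θ ^ n ≤ 1 := pow_le_one₀ hθ0.le hθ1.le
      have h1 := hstep (C * (1 / 2) ^ n) (1 + D * (1 - θ ^ n)) (by positivity)
        (by have := mul_nonneg hD0.le (by linarith : 0 ≤ 1 - θ ^ n); linarith) ih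
      have h2 : (C * (1 / 2) ^ n) ^ (1 - q) = C ^ (1 - q) * θ ^ n := by
        rw [Real.mul_rpow hC0.le (by positivity), hθ, Real.rpow_pow_comm (by norm_num)]
      have h3 : 6 * Real.log 2 / B * (C ^ (1 - q) * θ ^ n) = D * (1 - θ) * θ ^ n := by
        rw [hD, div_mul_cancel₀ _ h1θ.ne']; ring
      rw [h2, h3] at h1
      filter_upwards [h1] with p hp hpt
      have h4 := hp (by rw [pow_succ] at hpt; linarith)
      rw [pow_succ]
      linarith
  refine ⟨1 + D, by positivity, ?_⟩
  have hfin : ∀ᵐ p : FTE.PS N, 1 + D ≤ p.1 → u p.1 p.2 = 0 := by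
    filter_upwards [ae_all_iff.2 hit] with p hp hpt
    have hlim : Filter.Tendsto (fun n : ℕ => C * (1 / 2 : ℝ) ^ n) Filter.atTop (nhds (C * 0)) :=
      (tendsto_pow_atTop_nhds_zero_of_lt_one (by norm_num) (by norm_num)).const_mul C
    rw [mul_zero] at hlim
    refine le_antisymm (ge_of_tendsto' hlim fun n => hp n ?_) (hun _ _)
    have : 0 ≤ D * θ ^ n := by positivity
    linarith
  have h2 := Measure.ae_ae_of_ae_prod hfin
  filter_upwards [h2] with t ht htT
  filter_upwards [ht] with x hx
  exact hx htT
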